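/- arXiv:1511.03324 — 3 statements merged into one kernel-verified Lean document; each statement's English description precedes it below -/
import Mathlib

section
/- There exists a constant C > 0 with the following property. For every σ ∈ [0, 1], all 2 ≤ s₀ ≤ s, and every smooth function u : ℝ × ℝ³ → ℝ vanishing outside the future light cone K, one has ∥(s/t)^{−σ} s^{−1} u∥_{L²_f(H_s)} ≤ C ∥(s₀/t)^{−σ} s₀^{−1} u∥_{L²_f(H_{s₀})} + C Σ_{a=1}^{3} ∥∂̄_a u∥_{L²_f(H_s)} + C Σ_{a=1}^{3} ∫_{s₀}^{s} τ^{−1} ( ∥(τ/t)^{1−σ} ∂_a u∥_{L²_f(H_τ)} + ∥∂̄_a u∥_{L²_f(H_τ)} ) dτ. Here, on a hyperboloid H_τ, the weight (τ/t) denotes the function x ↦ τ/√(τ² + |x|²). -/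
noncomputable section
open MeasureTheory

/-- Spatial part: Euclidean 3-space. -/
abbrev E3 : Type := EuclideanSpace ℝ (Fin 3)

/-- Spacetime points `(t, x) ∈ ℝ × ℝ³`. -/
abbrev Spt : Type := ℝ × E3

/-- Time derivative `∂_t`. -/
def dt (u : Spt → ℝ) : Spt → ℝ := fun p => fderiv ℝ u p (1, 0)

/-- Spatial derivative `∂_a`, `a = 1,2,3`. -/
def dx (a : Fin 3) (u : Spt → ℝ) : Spt → ℝ :=
  fun p => fderiv ℝ u p (0, EuclideanSpace.single a 1)

/-- Semi-hyperboloidal derivative `∂̄_a = (x^a/t) ∂_t + ∂_a`. -/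
def shd (a : Fin 3) (u : Spt → ℝ) : Spt → ℝ :=
  fun p => (p.2 a / p.1) * dt u p + dx a u p

/-- The future light cone `K = {(t,x) : |x| < t − 1}`. -/
def lightCone : Set Spt := {p : Spt | ‖p.2‖ < p.1 - 1}

/-- The flat `L²` norm on the hyperboloid `H_τ`:
`‖v‖_{L²_f(H_τ)} = (∫_{ℝ³} |v(√(τ² + |x|²), x)|² dx)^{1/2}`. -/
def hypNorm (τ : ℝ) (v : Spt → ℝ) : ℝ :=
  Real.sqrt (∫ x : E3, (v (Real.sqrt (τ ^ 2 + ‖x‖ ^ 2), x)) ^ 2)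

/-- The `L²` norm of a real function on Euclidean 3-space. -/
def l2Norm (g : E3 → ℝ) : ℝ := Real.sqrt (∫ x, g x ^ 2)

lemma l2Norm_nonneg (g : E3 → ℝ) : 0 ≤ l2Norm g := Real.sqrt_nonneg _

lemma sq_l2Norm (g : E3 → ℝ) : l2Norm g ^ 2 = ∫ x, g x ^ 2 :=
  Real.sq_sqrt (integral_nonneg fun _ => sq_nonneg _)

lemma toReal_eLpNorm_two {g : E3 → ℝ} (hg : MemLp g 2 volume) :
    (eLpNorm g 2 volume).toReal = l2Norm g := by
  rw [hg.eLpNorm_eq_integral_rpow_norm (by norm_num) (by norm_num),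
    ENNReal.toReal_ofReal (by positivity), l2Norm, Real.sqrt_eq_rpow]
  simp

lemma l2Norm_mono {f g : E3 → ℝ} (hg : MemLp g 2 volume) (h : ∀ x, |f x| ≤ g x) :
    l2Norm f ≤ l2Norm g := by
  refine Real.sqrt_le_sqrt (integral_mono_of_nonneg (.of_forall fun x => sq_nonneg _)
    hg.integrable_sq (.of_forall fun x => ?_))
  exact sq_le_sq.2 ((h x).trans (le_abs_self _))

lemma l2Norm_add_le {f g : E3 → ℝ} (hf : MemLp f 2 volume) (hg : MemLp g 2 volume) :
    l2Norm (fun x => f x + g x) ≤ l2Norm f + l2Norm g := by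
  have h := eLpNorm_add_le hf.1 hg.1 (p := 2) (by norm_num)
  change l2Norm (f + g) ≤ _
  rw [← toReal_eLpNorm_two hf, ← toReal_eLpNorm_two hg, ← toReal_eLpNorm_two (hf.add hg),
    ← ENNReal.toReal_add hf.2.ne hg.2.ne]
  exact ENNReal.toReal_mono (ENNReal.add_lt_top.2 ⟨hf.2, hg.2⟩).ne h

lemma l2Norm_sum_le {ι : Type*} (s : Finset ι) {f : ι → E3 → ℝ}
    (hf : ∀ i, MemLp (f i) 2 volume) :
    l2Norm (fun x => ∑ i ∈ s, f i x) ≤ ∑ i ∈ s, l2Norm (f i) := by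
  classical
  induction s using Finset.induction_on with
  | empty => simp [l2Norm]
  | insert i s hi ih =>
    simp only [Finset.sum_insert hi]
    exact (l2Norm_add_le (hf i) (memLp_finsetSum s fun j _ => hf j)).trans (by gcongr)

lemma l2Norm_const_mul {c : ℝ} (hc : 0 ≤ c) (g : E3 → ℝ) :
    l2Norm (fun x => c * g x) = c * l2Norm g := by
  simp only [l2Norm, mul_pow]
  rw [integral_const_mul, Real.sqrt_mul (sq_nonneg c), Real.sqrt_sq hc]

lemma l2Norm_abs (g : E3 → ℝ) : l2Norm (fun x => |g x|) = l2Norm g := by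
  simp [l2Norm]

lemma integral_mul_le_l2Norm_mul {f g : E3 → ℝ} (hf : MemLp f 2 volume)
    (hg : MemLp g 2 volume) : ∫ x, f x * g x ≤ l2Norm f * l2Norm g := by
  have h := integral_mul_norm_le_Lp_mul_Lq (μ := volume) (f := f) (g := g)
    (p := 2) (q := 2) (by constructor <;> norm_num) (by simpa using hf) (by simpa using hg)
  have e : ∀ v : E3 → ℝ, (∫ x, ‖v x‖ ^ (2 : ℝ)) ^ (1 / (2 : ℝ)) = l2Norm v := by
    intro v
    simp [l2Norm, Real.sqrt_eq_rpow]
  rw [e, e] at h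
  refine (integral_mono (hf.integrable_mul hg) (hf.norm.integrable_mul hg.norm) fun x => ?_).trans h
  simpa [abs_mul] using le_abs_self (f x * g x)

lemma continuousOn_l2Norm {a b : ℝ} {k : Set E3} (hk : IsCompact k) {G : ℝ → E3 → ℝ}
    (hG : ContinuousOn (Function.uncurry G) (Set.Icc a b ×ˢ Set.univ))
    (hGk : ∀ τ x, τ ∈ Set.Icc a b → x ∉ k → G τ x = 0) :
    ContinuousOn (fun τ => l2Norm (G τ)) (Set.Icc a b) :=
  Real.continuous_sqrt.comp_continuousOn (continuousOn_integral_of_compact_support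
    (f := fun τ x => G τ x ^ 2) hk (hG.pow 2) fun τ x hτ hx => by simp [hGk τ x hτ hx])

lemma memLp_two_of_compact {k : Set E3} (hk : IsCompact k) {g : E3 → ℝ} (hg : Continuous g)
    (hgk : ∀ x, x ∉ k → g x = 0) : MemLp g 2 volume :=
  hg.memLp_of_hasCompactSupport (HasCompactSupport.intro hk fun x hx => hgk x hx)

/-- Minkowski's integral inequality for a continuous family of compactly supported functions. -/
lemma l2Norm_intervalIntegral_le {a b : ℝ} (hab : a ≤ b) {k : Set E3} (hk : IsCompact k)
    {G : ℝ → E3 → ℝ} (hG : ContinuousOn (Function.uncurry G) (Set.Icc a b ×ˢ Set.univ))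
    (hGk : ∀ τ x, τ ∈ Set.Icc a b → x ∉ k → G τ x = 0) :
    MemLp (fun x => ∫ τ in a..b, G τ x) 2 volume ∧
    l2Norm (fun x => ∫ τ in a..b, G τ x) ≤ ∫ τ in a..b, l2Norm (G τ) := by
  set H : E3 → ℝ := fun x => ∫ τ in a..b, G τ x with hH
  have hHset : ∀ x, H x = ∫ τ in Set.Icc a b, G τ x := fun x => by
    simp only [hH]
    rw [integral_Icc_eq_integral_Ioc, intervalIntegral.integral_of_le hab]
  have hHc : Continuous H := by
    have h1 : Continuous (Function.uncurry fun x τ => G (Set.projIcc a b hab τ) x) :=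
      hG.comp_continuous (f := fun p : E3 × ℝ => ((Set.projIcc a b hab p.2 : ℝ), p.1))
        (by fun_prop) fun p => ⟨(Set.projIcc a b hab p.2).2, trivial⟩
    have h2 := intervalIntegral.continuous_parametric_intervalIntegral_of_continuous'
      (μ := volume) h1 a b
    convert h2 using 2 with x
    refine intervalIntegral.integral_congr fun τ hτ => ?_
    rw [Set.uIcc_of_le hab] at hτ
    simp [Set.projIcc_of_mem hab hτ]
  have hHk : ∀ x, x ∉ k → H x = 0 := fun x hx => by
    rw [hHset]
    exact setIntegral_eq_zero_of_forall_eq_zero fun τ hτ => hGk τ x hτ hx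
  have hHm := memLp_two_of_compact hk hHc hHk
  have hGm : ∀ τ ∈ Set.Icc a b, MemLp (G τ) 2 volume := fun τ hτ =>
    memLp_two_of_compact hk (hG.comp_continuous (f := fun x : E3 => (τ, x)) (by fun_prop)
      fun x => ⟨hτ, trivial⟩) fun x => hGk τ x hτ
  refine ⟨hHm, ?_⟩
  have hprod : Integrable (Function.uncurry fun x τ => H x * G τ x)
      (volume.prod (volume.restrict (Set.Icc a b))) := by
    have h1 : ContinuousOn (Function.uncurry fun x τ => H x * G τ x)
        (k ×ˢ Set.Icc a b) := by
      refine (hHc.comp continuous_fst).continuousOn.mul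
        (hG.comp (f := fun p : E3 × ℝ => (p.2, p.1)) (by fun_prop) fun p hp => ⟨hp.2, trivial⟩)
    have h2 := h1.integrableOn_compact (μ := (volume : Measure E3).prod volume)
      (hk.prod isCompact_Icc)
    have h3 := h2.of_forall_sdiff_eq_zero (t := Set.univ ×ˢ Set.Icc a b)
      (MeasurableSet.univ.prod measurableSet_Icc) (by
        rintro ⟨x, τ⟩ ⟨h, h'⟩
        have hx : x ∉ k := fun hx => h' ⟨hx, h.2⟩
        simp [hHk x hx])
    rwa [IntegrableOn, ← Measure.prod_restrict, Measure.restrict_univ] at h3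
  have hcont := continuousOn_l2Norm hk hG hGk
  have key : l2Norm H ^ 2 ≤ l2Norm H * ∫ τ in a..b, l2Norm (G τ) := by
    calc l2Norm H ^ 2 = ∫ x, ∫ τ in Set.Icc a b, H x * G τ x := by
          rw [sq_l2Norm]
          congr 1 with x
          rw [integral_const_mul, ← hHset, sq]
      _ = ∫ τ in Set.Icc a b, ∫ x, H x * G τ x := integral_integral_swap hprod
      _ ≤ ∫ τ in Set.Icc a b, l2Norm H * l2Norm (G τ) := by
          refine setIntegral_mono_on hprod.integral_prod_right
            ((hcont.const_mul _).integrableOn_compact isCompact_Icc) measurableSet_Icc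
            fun τ hτ => integral_mul_le_l2Norm_mul hHm (hGm τ hτ)
      _ = l2Norm H * ∫ τ in a..b, l2Norm (G τ) := by
          rw [integral_const_mul, integral_Icc_eq_integral_Ioc,
            intervalIntegral.integral_of_le hab]
  rcases (l2Norm_nonneg H).eq_or_lt with h0 | h0
  · rw [← h0]
    exact intervalIntegral.integral_nonneg hab fun _ _ => l2Norm_nonneg _
  · rw [sq] at key
    exact le_of_mul_le_mul_left key h0

/-- Hardy's inequality with a regularized weight. -/
lemma integral_sq_div_le {f : E3 → ℝ} (hf : ContDiff ℝ 1 f) (hfs : HasCompactSupport f)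
    {s : ℝ} (hs : 0 < s) :
    ∫ x, f x ^ 2 / (s ^ 2 + ‖x‖ ^ 2) ≤
      4 * ∫ x, ∑ a : Fin 3, fderiv ℝ f x (EuclideanSpace.single a 1) ^ 2 := by
  set e : Fin 3 → E3 := fun a => EuclideanSpace.single a 1 with he
  have hpos : ∀ x : E3, 0 < s ^ 2 + ‖x‖ ^ 2 := fun x => by positivity
  set h : Fin 3 → E3 → ℝ := fun a x => x a * (s ^ 2 + ‖x‖ ^ 2)⁻¹ * f x ^ 2 with hh
  have hcoord : ∀ a, ContDiff ℝ 1 fun x : E3 => x a := fun a => by fun_prop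
  have hw : ContDiff ℝ 1 fun x : E3 => (s ^ 2 + ‖x‖ ^ 2)⁻¹ :=
    (contDiff_const.add (contDiff_norm_sq ℝ)).inv fun x => (hpos x).ne'
  have hhc : ∀ a, ContDiff ℝ 1 (h a) := fun a => ((hcoord a).mul hw).mul (hf.pow 2)
  have hhs : ∀ a, HasCompactSupport (h a) := fun a =>
    hfs.mono fun x hx hfx => hx (by simp [hh, hfx])
  have hD : ∀ a, Continuous fun x => fderiv ℝ (h a) x (e a) := fun a =>
    ((hhc a).continuous_fderiv one_ne_zero).clm_apply continuous_const
  have hDs : ∀ a, HasCompactSupport fun x => fderiv ℝ (h a) x (e a) := fun a =>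
    (hhs a).fderiv_apply ℝ (e a)
  have hDf : ∀ a, Continuous fun x => fderiv ℝ f x (e a) := fun a =>
    (hf.continuous_fderiv one_ne_zero).clm_apply continuous_const
  have hDfs : ∀ a, HasCompactSupport fun x => fderiv ℝ f x (e a) := fun a =>
    hfs.fderiv_apply ℝ (e a)
  have hzero : ∀ a, ∫ x, fderiv ℝ (h a) x (e a) = 0 := fun a => by
    have := integral_mul_fderiv_eq_neg_fderiv_mul_of_integrable (μ := (volume : Measure E3))
      (f := fun _ => (1 : ℝ)) (g := h a) (v := e a) (by simp)
      (by simpa using (hD a).integrable_of_hasCompactSupport (hDs a))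
      (by simpa using (hhc a).continuous.integrable_of_hasCompactSupport (hhs a))
      (fun x _ => by fun_prop) (fun x _ => (hhc a).differentiable one_ne_zero x)
    simpa using this
  have hderiv : ∀ a x, fderiv ℝ (h a) x (e a) =
      ((s ^ 2 + ‖x‖ ^ 2)⁻¹ - 2 * (x a) ^ 2 * ((s ^ 2 + ‖x‖ ^ 2)⁻¹) ^ 2) * f x ^ 2
        + x a * (s ^ 2 + ‖x‖ ^ 2)⁻¹ * (2 * f x * fderiv ℝ f x (e a)) := by
    intro a x
    have d1 : HasFDerivAt (fun x : E3 => x a) (EuclideanSpace.proj a : E3 →L[ℝ] ℝ) x :=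
      (EuclideanSpace.proj a : E3 →L[ℝ] ℝ).hasFDerivAt
    have d2 : HasFDerivAt (fun x : E3 => s ^ 2 + ‖x‖ ^ 2) (2 • innerSL ℝ x) x :=
      (hasStrictFDerivAt_norm_sq x).hasFDerivAt.const_add _
    have d3 := (hf.differentiable one_ne_zero x).hasFDerivAt
    have d : fderiv ℝ (h a) x = _ :=
      ((d1.mul ((hasDerivAt_inv (hpos x).ne').comp_hasFDerivAt x d2)).mul (d3.pow 2)).fderiv
    rw [d]
    simp [he, EuclideanSpace.inner_single_right]
    ring
  have hpt : ∀ x, f x ^ 2 / (s ^ 2 + ‖x‖ ^ 2) ≤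
      2 * ∑ a, fderiv ℝ (h a) x (e a) + 4 * ∑ a, fderiv ℝ f x (e a) ^ 2 := by
    intro x
    have hn : ‖x‖ ^ 2 = x 0 ^ 2 + x 1 ^ 2 + x 2 ^ 2 := by
      rw [EuclideanSpace.real_norm_sq_eq, Fin.sum_univ_three]
    simp only [hderiv, div_eq_mul_inv, Fin.sum_univ_three]
    have hq := hpos x
    set q := s ^ 2 + ‖x‖ ^ 2 with hqd
    have hq1 : q⁻¹ * q = 1 := inv_mul_cancel₀ hq.ne'
    have hq2 : q⁻¹ ^ 2 * (x 0 ^ 2 + x 1 ^ 2 + x 2 ^ 2) ≤ q⁻¹ := by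
      rw [← hn, sq, mul_assoc]
      refine mul_le_of_le_one_right (inv_nonneg.2 hq.le) ?_
      rw [← hq1]
      gcongr
      rw [hqd]; nlinarith [sq_nonneg s]
    generalize q⁻¹ = w at *
    nlinarith [sq_nonneg (f x * x 0 * w + 2 * fderiv ℝ f x (e 0)),
      sq_nonneg (f x * x 1 * w + 2 * fderiv ℝ f x (e 1)),
      sq_nonneg (f x * x 2 * w + 2 * fderiv ℝ f x (e 2)),
      mul_le_mul_of_nonneg_right hq2 (sq_nonneg (f x))]
  have i1 : ∀ a, Integrable fun x => fderiv ℝ (h a) x (e a) := fun a =>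
    (hD a).integrable_of_hasCompactSupport (hDs a)
  have i2 : ∀ a, Integrable fun x => fderiv ℝ f x (e a) ^ 2 := fun a =>
    ((hDf a).memLp_of_hasCompactSupport (hDfs a)).integrable_sq
  have i1' := (integrable_finsetSum Finset.univ fun a _ => i1 a).const_mul 2
  have i2' := (integrable_finsetSum Finset.univ fun a _ => i2 a).const_mul 4
  calc ∫ x, f x ^ 2 / (s ^ 2 + ‖x‖ ^ 2)
      ≤ ∫ x, (2 * ∑ a, fderiv ℝ (h a) x (e a) + 4 * ∑ a, fderiv ℝ f x (e a) ^ 2) :=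
        integral_mono_of_nonneg (.of_forall fun x => by positivity) (i1'.add i2')
          (.of_forall hpt)
    _ = _ := by
        rw [integral_add i1' i2', integral_const_mul, integral_const_mul,
          integral_finsetSum _ fun a _ => i1 a]
        simp only [hzero, Finset.sum_const_zero, mul_zero, zero_add]
        rfl

/-- The point of the hyperboloid `H_τ` above `x`. -/
def hypPt (τ : ℝ) (x : E3) : Spt := (Real.sqrt (τ ^ 2 + ‖x‖ ^ 2), x)

lemma hypNorm_eq_l2Norm (τ : ℝ) (v : Spt → ℝ) :
    hypNorm τ v = l2Norm fun x => v (hypPt τ x) := rfl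

lemma continuous_hypPt : Continuous fun p : ℝ × E3 => hypPt p.1 p.2 := by
  unfold hypPt
  fun_prop

lemma hypPt_fst_pos {τ : ℝ} (hτ : 0 < τ) (x : E3) : 0 < (hypPt τ x).1 :=
  Real.sqrt_pos.2 (by positivity)

lemma sq_hypPt_fst (τ : ℝ) (x : E3) : (hypPt τ x).1 ^ 2 = τ ^ 2 + ‖x‖ ^ 2 :=
  Real.sq_sqrt (by positivity)

lemma le_hypPt_fst (τ : ℝ) (x : E3) : τ ≤ (hypPt τ x).1 :=
  Real.le_sqrt_of_sq_le (by nlinarith [sq_nonneg ‖x‖])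

lemma div_hypPt_fst_mono {τ s : ℝ} (hτ : 0 < τ) (hs : τ ≤ s) (x : E3) :
    τ / (hypPt τ x).1 ≤ s / (hypPt s x).1 := by
  have h1 := hypPt_fst_pos hτ x
  have h2 := hypPt_fst_pos (hτ.trans_le hs) x
  rw [div_le_div_iff₀ h1 h2, ← sq_le_sq₀ (by positivity) (mul_pos (hτ.trans_le hs) h1).le,
    mul_pow, mul_pow, sq_hypPt_fst, sq_hypPt_fst]
  have : τ ^ 2 ≤ s ^ 2 := by gcongr
  nlinarith [mul_le_mul_of_nonneg_right this (sq_nonneg ‖x‖)]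

lemma hasDerivAt_comp_hypPt {u : Spt → ℝ} (hu : Differentiable ℝ u) {τ : ℝ} (hτ : 0 < τ)
    (x : E3) : HasDerivAt (fun τ => u (hypPt τ x))
      (τ / (hypPt τ x).1 * dt u (hypPt τ x)) τ := by
  have h1 : HasDerivAt (fun τ : ℝ => Real.sqrt (τ ^ 2 + ‖x‖ ^ 2)) (τ / (hypPt τ x).1) τ := by
    have h := ((hasDerivAt_pow 2 τ).add_const (‖x‖ ^ 2)).sqrt (by positivity)
    refine h.congr_deriv ?_
    simp only [hypPt]
    field_simp
    simp
  have h2 : HasDerivAt (fun τ => hypPt τ x) (τ / (hypPt τ x).1, 0) τ :=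
    h1.prodMk (hasDerivAt_const τ x)
  refine ((hu (hypPt τ x)).hasFDerivAt.comp_hasDerivAt τ h2).congr_deriv ?_
  rw [dt, ← smul_eq_mul, ← (fderiv ℝ u (hypPt τ x)).map_smul]
  simp

lemma contDiff_hypPt {s : ℝ} (hs : 0 < s) : ContDiff ℝ 1 (hypPt s) :=
  ((contDiff_const.add (contDiff_norm_sq ℝ)).sqrt fun x => by positivity).prodMk contDiff_id

lemma fderiv_comp_hypPt {u : Spt → ℝ} (hu : Differentiable ℝ u) {s : ℝ} (hs : 0 < s)
    (x : E3) (a : Fin 3) :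
    fderiv ℝ (fun x => u (hypPt s x)) x (EuclideanSpace.single a 1) = shd a u (hypPt s x) := by
  have h1 : HasFDerivAt (fun x : E3 => s ^ 2 + ‖x‖ ^ 2) (2 • innerSL ℝ x) x :=
    (hasStrictFDerivAt_norm_sq x).hasFDerivAt.const_add _
  have h2 : HasFDerivAt (hypPt s) _ x :=
    (h1.sqrt (by positivity)).prodMk (hasFDerivAt_id x)
  have h3 := (hu (hypPt s x)).hasFDerivAt.comp x h2
  have h4 : fderiv ℝ (fun x => u (hypPt s x)) x = _ := h3.fderiv
  have h5 : ((x a / (hypPt s x).1, EuclideanSpace.single a 1) : Spt) =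
      (x a / (hypPt s x).1) • ((1, 0) : Spt) + (0, EuclideanSpace.single a 1) := by simp
  have h6 : (hypPt s x).2 = x := rfl
  rw [h4, shd, dt, dx, h6, ← smul_eq_mul (x a / _), ← (fderiv ℝ u (hypPt s x)).map_smul,
    ← (fderiv ℝ u (hypPt s x)).map_add, ← h5]
  simp [hypPt, EuclideanSpace.inner_single_right]
  congr 2
  field_simp

lemma eventuallyEq_zero_hypPt {u : Spt → ℝ} (hu : ∀ p, p ∉ lightCone → u p = 0) {τ s : ℝ}
    (hτ : 0 < τ) (hs : τ ≤ s) {x : E3} (hx : x ∉ Metric.closedBall (0 : E3) (s ^ 2)) :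
    u =ᶠ[nhds (hypPt τ x)] 0 := by
  have hx' : s ^ 2 < ‖x‖ := by simpa using hx
  have ho : IsOpen {p : Spt | p.1 - 1 < ‖p.2‖} :=
    isOpen_lt (by fun_prop) (by fun_prop)
  have hmem : hypPt τ x ∈ {p : Spt | p.1 - 1 < ‖p.2‖} := by
    have : Real.sqrt (τ ^ 2 + ‖x‖ ^ 2) < ‖x‖ + 1 :=
      (Real.sqrt_lt' (by positivity)).2 (by nlinarith [norm_nonneg x])
    simp only [hypPt, Set.mem_ofPred_eq]
    linarith
  filter_upwards [ho.mem_nhds hmem] with p hp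
  exact hu p (not_lt.2 (le_of_lt hp))

lemma abs_dt_le (u : Spt → ℝ) {τ : ℝ} (hτ : 0 < τ) {x : E3} (hx : τ ≤ ‖x‖) :
    |dt u (hypPt τ x)| ≤ 2 * ∑ a, (|dx a u (hypPt τ x)| + |shd a u (hypPt τ x)|) := by
  have hT := hypPt_fst_pos hτ x
  have hT2 := sq_hypPt_fst τ x
  have hr : 0 < ‖x‖ := hτ.trans_le hx
  have hTr : (hypPt τ x).1 ≤ 2 * ‖x‖ := by nlinarith
  have hn : ‖x‖ ^ 2 = x 0 ^ 2 + x 1 ^ 2 + x 2 ^ 2 := by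
    rw [EuclideanSpace.real_norm_sq_eq, Fin.sum_univ_three]
  have hc : ∀ a, |x a| ≤ ‖x‖ := fun a => PiLp.norm_apply_le x a
  set D := ∑ a, (|dx a u (hypPt τ x)| + |shd a u (hypPt τ x)|) with hD
  have hD0 : 0 ≤ D := Finset.sum_nonneg fun a _ => by positivity
  have hid : dt u (hypPt τ x) * ‖x‖ ^ 2 =
      (hypPt τ x).1 * ∑ a, x a * (shd a u (hypPt τ x) - dx a u (hypPt τ x)) := by
    have h6 : (hypPt τ x).2 = x := rfl
    simp only [shd, h6, add_sub_cancel_right, Fin.sum_univ_three]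
    rw [hn]
    field_simp
  have hsum : |∑ a, x a * (shd a u (hypPt τ x) - dx a u (hypPt τ x))| ≤ ‖x‖ * D := by
    rw [hD, Finset.mul_sum]
    refine (Finset.abs_sum_le_sum_abs _ _).trans (Finset.sum_le_sum fun a _ => ?_)
    rw [abs_mul, add_comm]
    gcongr
    · exact hc a
    · exact abs_sub _ _
  have h := congrArg abs hid
  rw [abs_mul, abs_mul, abs_of_pos hT, abs_of_nonneg (sq_nonneg ‖x‖)] at h
  refine le_of_mul_le_mul_right (a := ‖x‖ ^ 2) ?_ (by positivity)
  calc _ = _ := h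
    _ ≤ (2 * ‖x‖) * (‖x‖ * D) := by gcongr
    _ = _ := by ring

/-- The weight `(τ/t)^{-σ} τ⁻¹` decreases along `τ ↦ (√(τ² + |x|²), x)`. -/
lemma weight_antitone {σ : ℝ} (hσ : 0 ≤ σ) {τ s : ℝ} (hτ : 0 < τ) (hs : τ ≤ s) (x : E3) :
    (s / (hypPt s x).1) ^ (-σ) * s⁻¹ ≤ (τ / (hypPt τ x).1) ^ (-σ) * τ⁻¹ := by
  have h1 := hypPt_fst_pos hτ x
  have h2 := hypPt_fst_pos (hτ.trans_le hs) x
  have h3 := hτ.trans_le hs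
  gcongr ?_ * ?_
  · exact Real.rpow_le_rpow_of_nonpos (by positivity) (div_hypPt_fst_mono hτ hs x) (by linarith)
  · gcongr

lemma weight_le_of_norm_le {σ : ℝ} (hσ : σ ≤ 1) {s : ℝ} (hs : 0 < s) {x : E3} (hx : ‖x‖ ≤ s) :
    (s / (hypPt s x).1) ^ (-σ) * s⁻¹ ≤ 2 / (hypPt s x).1 := by
  have hT := hypPt_fst_pos hs x
  have h1 : (s / (hypPt s x).1) ^ (-σ) ≤ (s / (hypPt s x).1) ^ (-1 : ℝ) :=
    Real.rpow_le_rpow_of_exponent_ge (by positivity) ((div_le_one hT).2 (le_hypPt_fst s x))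
      (by linarith)
  rw [Real.rpow_neg_one, inv_div] at h1
  calc _ ≤ (hypPt s x).1 / s * s⁻¹ := by gcongr
    _ = (hypPt s x).1 ^ 2 / (s ^ 2 * (hypPt s x).1) := by field_simp
    _ ≤ 2 * s ^ 2 / (s ^ 2 * (hypPt s x).1) := by
        gcongr
        rw [sq_hypPt_fst]
        nlinarith [norm_nonneg x]
    _ = _ := by field_simp

lemma weight_mul_abs_le {σ : ℝ} (hσ : σ ∈ Set.Icc (0 : ℝ) 1) {s₀ s : ℝ} (hs₀ : 0 < s₀)
    (hs : s₀ ≤ s) {u : Spt → ℝ} (hu : ContDiff ℝ 1 u) {x : E3} (hx : s ≤ ‖x‖)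
    {G : ℝ → ℝ} (hG : ContinuousOn G (Set.Icc s₀ s))
    (hGu : ∀ τ ∈ Set.Icc s₀ s, τ⁻¹ * ∑ a, (|(τ / (hypPt τ x).1) ^ (1 - σ) * dx a u (hypPt τ x)|
      + |shd a u (hypPt τ x)|) ≤ G τ) :
    (s / (hypPt s x).1) ^ (-σ) * s⁻¹ * |u (hypPt s x)| ≤
      (s₀ / (hypPt s₀ x).1) ^ (-σ) * s₀⁻¹ * |u (hypPt s₀ x)| + 2 * ∫ τ in s₀..s, G τ := by
  have hspos : 0 < s := hs₀.trans_le hs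
  set w := (s / (hypPt s x).1) ^ (-σ) * s⁻¹ with hw
  have hw0 : 0 ≤ w := by
    have := hypPt_fst_pos hspos x
    positivity
  have hP : Continuous fun τ => hypPt τ x :=
    continuous_hypPt.comp (f := fun τ : ℝ => (τ, x)) (by fun_prop)
  have hd : ContinuousOn (fun τ => τ / (hypPt τ x).1 * dt u (hypPt τ x)) (Set.Icc s₀ s) := by
    refine (continuousOn_id.div (continuous_fst.comp hP).continuousOn fun τ hτ =>
      (hypPt_fst_pos (hs₀.trans_le hτ.1) x).ne').mul (Continuous.continuousOn ?_)
    exact ((hu.continuous_fderiv one_ne_zero).clm_apply continuous_const).comp hP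
  have hftc : ∫ τ in s₀..s, τ / (hypPt τ x).1 * dt u (hypPt τ x) =
      u (hypPt s x) - u (hypPt s₀ x) := by
    refine intervalIntegral.integral_eq_sub_of_hasDerivAt
      (f := fun τ => u (hypPt τ x)) (fun τ hτ => ?_) ?_
    · rw [Set.uIcc_of_le hs] at hτ
      exact hasDerivAt_comp_hypPt (hu.differentiable one_ne_zero) (hs₀.trans_le hτ.1) x
    · exact hd.intervalIntegrable_of_Icc hs
  have hbound : w * |∫ τ in s₀..s, τ / (hypPt τ x).1 * dt u (hypPt τ x)| ≤
      2 * ∫ τ in s₀..s, G τ := by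
    calc _ ≤ w * ∫ τ in s₀..s, |τ / (hypPt τ x).1 * dt u (hypPt τ x)| := by
          gcongr
          exact intervalIntegral.abs_integral_le_integral_abs hs
      _ = ∫ τ in s₀..s, w * |τ / (hypPt τ x).1 * dt u (hypPt τ x)| := by
          rw [intervalIntegral.integral_const_mul]
      _ ≤ ∫ τ in s₀..s, 2 * G τ := by
          refine intervalIntegral.integral_mono_on hs
            ((hd.abs.const_mul w).intervalIntegrable_of_Icc hs)
            ((hG.const_mul 2).intervalIntegrable_of_Icc hs) fun τ hτ => ?_
          have hτ0 : 0 < τ := hs₀.trans_le hτ.1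
          have hT := hypPt_fst_pos hτ0 x
          set ρ := τ / (hypPt τ x).1 with hρ
          have hρ0 : 0 < ρ := by positivity
          have hρ1 : ρ ≤ 1 := (div_le_one hT).2 (le_hypPt_fst τ x)
          have hρσ : ρ ^ (1 - σ) = ρ ^ (-σ) * ρ := by
            rw [sub_eq_neg_add, Real.rpow_add_one hρ0.ne']
          calc w * |ρ * dt u (hypPt τ x)|
              ≤ (ρ ^ (-σ) * τ⁻¹) * (ρ * |dt u (hypPt τ x)|) := by
                rw [abs_mul, abs_of_pos hρ0]
                gcongr
                exact weight_antitone hσ.1 hτ0 hτ.2 x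
            _ = τ⁻¹ * (ρ ^ (1 - σ) * |dt u (hypPt τ x)|) := by rw [hρσ]; ring
            _ ≤ τ⁻¹ * (ρ ^ (1 - σ) *
                (2 * ∑ a, (|dx a u (hypPt τ x)| + |shd a u (hypPt τ x)|))) := by
                gcongr
                exact abs_dt_le u hτ0 (hτ.2.trans hx)
            _ = 2 * (τ⁻¹ * ∑ a, (ρ ^ (1 - σ) * |dx a u (hypPt τ x)|
                + ρ ^ (1 - σ) * |shd a u (hypPt τ x)|)) := by
                simp only [← mul_add, ← Finset.mul_sum]
                ring
            _ ≤ 2 * (τ⁻¹ * ∑ a, (|ρ ^ (1 - σ) * dx a u (hypPt τ x)|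
                + |shd a u (hypPt τ x)|)) := by
                gcongr with a
                · rw [abs_mul, abs_of_nonneg (Real.rpow_nonneg hρ0.le _)]
                · exact mul_le_of_le_one_left (abs_nonneg _)
                    (Real.rpow_le_one hρ0.le hρ1 (by linarith [hσ.2]))
            _ ≤ 2 * G τ := by gcongr; exact hGu τ hτ
      _ = _ := intervalIntegral.integral_const_mul _ _
  have habs : |u (hypPt s x)| ≤ |u (hypPt s₀ x)| +
      |∫ τ in s₀..s, τ / (hypPt τ x).1 * dt u (hypPt τ x)| := by
    rw [hftc]
    linarith [abs_sub_abs_le_abs_sub (u (hypPt s x)) (u (hypPt s₀ x))]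
  calc w * |u (hypPt s x)| ≤ w * |u (hypPt s₀ x)| +
        w * |∫ τ in s₀..s, τ / (hypPt τ x).1 * dt u (hypPt τ x)| := by
        rw [← mul_add]
        gcongr
    _ ≤ _ := by
        gcongr
        exact weight_antitone hσ.1 hs₀ hs x

/-- Weighted Hardy inequality along the hyperboloidal foliation. On a hyperboloid
`H_τ` the weight `(τ/t)` stands for the function `x ↦ τ/√(τ² + |x|²)`, encoded here
as `τ/p.1` since `p.1 = √(τ² + |x|²)` on `H_τ`. -/
theorem weighted_hardy_inequality_on_hyperboloids :
    ∃ C > (0 : ℝ), ∀ σ : ℝ, σ ∈ Set.Icc (0 : ℝ) 1 →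
      ∀ s₀ s : ℝ, 2 ≤ s₀ → s₀ ≤ s →
      ∀ u : Spt → ℝ, ContDiff ℝ (⊤ : ℕ∞) u →
        (∀ p : Spt, p ∉ lightCone → u p = 0) →
        hypNorm s (fun p => (s / p.1) ^ (-σ) * s⁻¹ * u p) ≤
          C * hypNorm s₀ (fun p => (s₀ / p.1) ^ (-σ) * s₀⁻¹ * u p)
            + C * (∑ a : Fin 3, hypNorm s (shd a u))
            + C * ∑ a : Fin 3,
                ∫ τ in s₀..s,
                  τ⁻¹ * (hypNorm τ (fun p => (τ / p.1) ^ (1 - σ) * dx a u p)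
                    + hypNorm τ (shd a u)) := by
  refine ⟨4, by norm_num, fun σ hσ s₀ s hs₀2 hs u hu' hsupp => ?_⟩
  have hu : ContDiff ℝ 1 u := hu'.of_le (by exact_mod_cast le_top)
  have hud : Differentiable ℝ u := hu.differentiable one_ne_zero
  have hs₀ : 0 < s₀ := by linarith
  have hspos : 0 < s := by linarith
  simp only [hypNorm_eq_l2Norm]
  set k : Set E3 := Metric.closedBall 0 (s ^ 2)
  have hk : IsCompact k := isCompact_closedBall 0 (s ^ 2)
  have hposIcc : ∀ τ ∈ Set.Icc s₀ s, 0 < τ := fun τ hτ => hs₀.trans_le hτ.1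
  -- support and continuity of `u` and its derivatives on the hyperboloids
  have hev : ∀ τ x, τ ∈ Set.Icc s₀ s → x ∉ k → u =ᶠ[nhds (hypPt τ x)] 0 := fun τ x hτ hx =>
    eventuallyEq_zero_hypPt hsupp (hposIcc τ hτ) hτ.2 hx
  have hfd : ∀ τ x, τ ∈ Set.Icc s₀ s → x ∉ k → fderiv ℝ u (hypPt τ x) = 0 := fun τ x hτ hx => by
    rw [(hev τ x hτ hx).fderiv_eq]
    simp
  have hu0 : ∀ τ x, τ ∈ Set.Icc s₀ s → x ∉ k → u (hypPt τ x) = 0 := fun τ x hτ hx =>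
    (hev τ x hτ hx).eq_of_nhds
  have hTc : ContinuousOn (fun p : ℝ × E3 => (hypPt p.1 p.2).1) (Set.Icc s₀ s ×ˢ Set.univ) :=
    (continuous_fst.comp continuous_hypPt).continuousOn
  have hTne : ∀ p ∈ Set.Icc s₀ s ×ˢ (Set.univ : Set E3), (hypPt p.1 p.2).1 ≠ 0 := fun p hp =>
    (hypPt_fst_pos (hposIcc _ hp.1) _).ne'
  have hwc : ∀ c : ℝ, ContinuousOn (fun p : ℝ × E3 => (p.1 / (hypPt p.1 p.2).1) ^ c)
      (Set.Icc s₀ s ×ˢ Set.univ) := fun c =>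
    (continuousOn_fst.div hTc hTne).rpow_const fun p hp => Or.inl
      (div_pos (hposIcc _ hp.1) (hypPt_fst_pos (hposIcc _ hp.1) _)).ne'
  have hfc : ∀ v : Spt, ContinuousOn (fun p : ℝ × E3 => fderiv ℝ u (hypPt p.1 p.2) v)
      (Set.Icc s₀ s ×ˢ Set.univ) := fun v =>
    (((hu.continuous_fderiv one_ne_zero).clm_apply continuous_const).comp
      continuous_hypPt).continuousOn
  set F : ℝ → E3 → ℝ := fun τ x => (τ / (hypPt τ x).1) ^ (-σ) * τ⁻¹ * u (hypPt τ x) with hF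
  set A : Fin 3 → ℝ → E3 → ℝ :=
    fun a τ x => (τ / (hypPt τ x).1) ^ (1 - σ) * dx a u (hypPt τ x) with hA
  set B : Fin 3 → ℝ → E3 → ℝ := fun a τ x => shd a u (hypPt τ x) with hB
  have hFc : ContinuousOn (Function.uncurry F) (Set.Icc s₀ s ×ˢ Set.univ) :=
    ((hwc _).mul (continuousOn_fst.inv₀ fun p hp => (hposIcc _ hp.1).ne')).mul
      (hu.continuous.comp continuous_hypPt).continuousOn
  have hAc : ∀ a, ContinuousOn (Function.uncurry (A a)) (Set.Icc s₀ s ×ˢ Set.univ) := fun a =>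
    (hwc _).mul (hfc _)
  have hBc : ∀ a, ContinuousOn (Function.uncurry (B a)) (Set.Icc s₀ s ×ˢ Set.univ) := fun a =>
    (((by fun_prop : Continuous fun p : ℝ × E3 => p.2 a).continuousOn.div hTc hTne).mul
      (hfc _)).add (hfc _)
  have hF0 : ∀ τ x, τ ∈ Set.Icc s₀ s → x ∉ k → F τ x = 0 := fun τ x hτ hx => by
    simp [hF, hu0 τ x hτ hx]
  have hA0 : ∀ a τ x, τ ∈ Set.Icc s₀ s → x ∉ k → A a τ x = 0 := fun a τ x hτ hx => by
    simp [hA, dx, hfd τ x hτ hx]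
  have hB0 : ∀ a τ x, τ ∈ Set.Icc s₀ s → x ∉ k → B a τ x = 0 := fun a τ x hτ hx => by
    simp [hB, shd, dt, dx, hfd τ x hτ hx]
  have hslice : ∀ {V : ℝ → E3 → ℝ}, ContinuousOn (Function.uncurry V)
      (Set.Icc s₀ s ×ˢ Set.univ) → (∀ τ x, τ ∈ Set.Icc s₀ s → x ∉ k → V τ x = 0) →
      ∀ τ ∈ Set.Icc s₀ s, MemLp (V τ) 2 volume := fun {V} hV hV0 τ hτ =>
    memLp_two_of_compact hk (hV.comp_continuous (f := fun x : E3 => (τ, x)) (by fun_prop)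
      fun x => ⟨hτ, trivial⟩) fun x => hV0 τ x hτ
  have hms₀ : s₀ ∈ Set.Icc s₀ s := ⟨le_rfl, hs⟩
  have hms : s ∈ Set.Icc s₀ s := ⟨hs, le_rfl⟩
  -- the contribution of the region away from the centre
  set G : ℝ → E3 → ℝ := fun τ x => τ⁻¹ * ∑ a, (|A a τ x| + |B a τ x|) with hG
  have hGc : ContinuousOn (Function.uncurry G) (Set.Icc s₀ s ×ˢ Set.univ) :=
    (continuousOn_fst.inv₀ fun p hp => (hposIcc _ hp.1).ne').mul
      (continuousOn_finsetSum _ fun a _ => (hAc a).abs.add (hBc a).abs)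
  have hG0 : ∀ τ x, τ ∈ Set.Icc s₀ s → x ∉ k → G τ x = 0 := fun τ x hτ hx => by
    simp [hG, hA0 _ τ x hτ hx, hB0 _ τ x hτ hx]
  have hGnn : ∀ τ x, τ ∈ Set.Icc s₀ s → 0 ≤ G τ x := fun τ x hτ =>
    mul_nonneg (inv_nonneg.2 (hposIcc τ hτ).le) (Finset.sum_nonneg fun a _ => by positivity)
  obtain ⟨hIm, hI⟩ := l2Norm_intervalIntegral_le hs hk hGc hG0
  have hGle : ∫ τ in s₀..s, l2Norm (G τ) ≤
      ∑ a, ∫ τ in s₀..s, τ⁻¹ * (l2Norm (A a τ) + l2Norm (B a τ)) := by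
    have hc : ∀ a, ContinuousOn (fun τ => τ⁻¹ * (l2Norm (A a τ) + l2Norm (B a τ)))
        (Set.Icc s₀ s) := fun a =>
      (continuousOn_id.inv₀ fun τ hτ => (hposIcc τ hτ).ne').mul
        ((continuousOn_l2Norm hk (hAc a) (hA0 a)).add (continuousOn_l2Norm hk (hBc a) (hB0 a)))
    rw [← intervalIntegral.integral_finsetSum fun a _ => (hc a).intervalIntegrable_of_Icc hs]
    refine intervalIntegral.integral_mono_on hs
      ((continuousOn_l2Norm hk hGc hG0).intervalIntegrable_of_Icc hs)
      ((continuousOn_finsetSum _ fun a _ => hc a).intervalIntegrable_of_Icc hs) fun τ hτ => ?_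
    have hmA : ∀ a, MemLp (fun x => |A a τ x|) 2 volume := fun a =>
      (hslice (hAc a) (hA0 a) τ hτ).abs
    have hmB : ∀ a, MemLp (fun x => |B a τ x|) 2 volume := fun a =>
      (hslice (hBc a) (hB0 a) τ hτ).abs
    rw [← Finset.mul_sum]
    refine (l2Norm_const_mul (inv_nonneg.2 (hposIcc τ hτ).le) _).trans_le ?_
    refine mul_le_mul_of_nonneg_left ?_ (inv_nonneg.2 (hposIcc τ hτ).le)
    refine (l2Norm_sum_le _ fun a => (hmA a).add (hmB a)).trans (Finset.sum_le_sum fun a _ => ?_)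
    rw [← l2Norm_abs (A a τ), ← l2Norm_abs (B a τ)]
    exact l2Norm_add_le (hmA a) (hmB a)
  -- the contribution of the region near the centre
  set N : E3 → ℝ := fun x => u (hypPt s x) / (hypPt s x).1 with hN
  have hfC : ContDiff ℝ 1 fun x => u (hypPt s x) := hu.comp (contDiff_hypPt hspos)
  have hNc : Continuous N := hfC.continuous.div
    (continuous_fst.comp (contDiff_hypPt hspos).continuous) fun x => (hypPt_fst_pos hspos x).ne'
  have hNm : MemLp N 2 volume := memLp_two_of_compact hk hNc fun x hx => by
    simp [hN, hu0 s x hms hx]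
  have hNle : l2Norm N ≤ 2 * ∑ a, l2Norm (B a s) := by
    have h := integral_sq_div_le hfC (HasCompactSupport.intro hk fun x => hu0 s x hms) hspos
    simp only [fderiv_comp_hypPt hud hspos] at h
    rw [integral_finsetSum _ fun a _ => (hslice (hBc a) (hB0 a) s hms).integrable_sq] at h
    have h1 : l2Norm N ^ 2 ≤ 4 * ∑ a, l2Norm (B a s) ^ 2 := by
      simp only [sq_l2Norm, hN, div_pow, sq_hypPt_fst]
      exact h
    have h2 : ∑ a, l2Norm (B a s) ^ 2 ≤ (∑ a, l2Norm (B a s)) ^ 2 := by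
      have hB0 := fun a => l2Norm_nonneg (B a s)
      simp only [Fin.sum_univ_three]
      nlinarith [mul_nonneg (hB0 0) (hB0 1), mul_nonneg (hB0 0) (hB0 2),
        mul_nonneg (hB0 1) (hB0 2)]
    have h3 : 0 ≤ ∑ a, l2Norm (B a s) := Finset.sum_nonneg fun a _ => l2Norm_nonneg _
    refine (sq_le_sq₀ (l2Norm_nonneg _) (by positivity)).1 ?_
    rw [mul_pow]
    linarith
  have hpt : ∀ x, |F s x| ≤ |F s₀ x| + 2 * (∫ τ in s₀..s, G τ x) + 2 * |N x| := by
    intro x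
    have hw : ∀ τ, 0 < τ → |F τ x| =
        (τ / (hypPt τ x).1) ^ (-σ) * τ⁻¹ * |u (hypPt τ x)| := fun τ hτ => by
      have := hypPt_fst_pos hτ x
      rw [hF, abs_mul, abs_of_nonneg (by positivity)]
    have hI0 : 0 ≤ ∫ τ in s₀..s, G τ x :=
      intervalIntegral.integral_nonneg hs fun τ hτ => hGnn τ x hτ
    rcases le_total s ‖x‖ with hx | hx
    · have h := weight_mul_abs_le hσ hs₀ hs hu hx (G := fun τ => G τ x)
        (hGc.comp (f := fun τ : ℝ => (τ, x)) (by fun_prop) fun τ hτ => ⟨hτ, trivial⟩)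
        fun τ _ => le_rfl
      rw [← hw s hspos, ← hw s₀ hs₀] at h
      linarith [abs_nonneg (N x)]
    · have h : |F s x| ≤ 2 * |N x| := by
        have hT := hypPt_fst_pos hspos x
        rw [hw s hspos, hN, abs_div, abs_of_pos hT]
        calc _ ≤ 2 / (hypPt s x).1 * |u (hypPt s x)| := by
              gcongr
              exact weight_le_of_norm_le hσ.2 hspos hx
          _ = _ := by ring
      linarith [abs_nonneg (F s₀ x)]
  have hFm : MemLp (fun x => |F s₀ x|) 2 volume := (hslice hFc hF0 s₀ hms₀).abs
  have hI2 := hIm.const_mul 2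
  have hN2 : MemLp (fun x => 2 * |N x|) 2 volume := hNm.abs.const_mul 2
  have htri : l2Norm (F s) ≤ l2Norm (F s₀) + 2 * l2Norm (fun x => ∫ τ in s₀..s, G τ x)
      + 2 * l2Norm N := by
    rw [← l2Norm_abs (F s₀), ← l2Norm_abs N, ← l2Norm_const_mul zero_le_two,
      ← l2Norm_const_mul zero_le_two]
    exact (l2Norm_mono ((hFm.add hI2).add hN2) hpt).trans
      ((l2Norm_add_le (hFm.add hI2) hN2).trans (by gcongr; exact l2Norm_add_le hFm hI2))
  have hIle := hI.trans hGle
  have hIn := (l2Norm_nonneg _).trans hIle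
  linarith [l2Norm_nonneg (F s₀)]
end
end

section
/- For all words I (letters in {0,1,2,3}) and J (letters in {1,2,3}) and every index α ∈ {0,1,2,3}, there exists a constant C, depending only on |I| and |J|, such that for every smooth function u defined on the future light cone K and every (t,x) ∈ K: |∂^I L^J( (s/t) ∂_α u )(t,x)| ≤ |(s/t) ∂_α ∂^I L^J u (t,x)| + C Σ_{β, I′, J′} |(s/t) ∂_β ∂^{I′} L^{J′} u (t,x)|, where the sum runs over β ∈ {0,1,2,3} and over all words I′ with |I′| ≤ |I| and J′ with |J′| ≤ |J|, and (s/t) denotes the function (t,x) ↦ √(t² − |x|²)/t. -/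
noncomputable section

/-- `∂_α` for `α ∈ {0,1,2,3}`, with `∂_0 = ∂_t`. -/
def pd : Fin 4 → (Spt → ℝ) → Spt → ℝ := ![dt, dx 0, dx 1, dx 2]

/-- Iterated derivatives `∂^I` for a word `I` in `{0,1,2,3}`. -/
def pdW : List (Fin 4) → (Spt → ℝ) → Spt → ℝ
  | [], u => u
  | α :: I, u => pd α (pdW I u)

/-- Lorentz boost `L_a = x^a ∂_t + t ∂_a`. -/
def lb (a : Fin 3) (u : Spt → ℝ) : Spt → ℝ :=
  fun p => p.2 a * dt u p + p.1 * dx a u p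

/-- Iterated Lorentz boosts `L^J` for a word `J` in `{1,2,3}`. -/
def lbW : List (Fin 3) → (Spt → ℝ) → Spt → ℝ
  | [], u => u
  | a :: J, u => lb a (lbW J u)

/-- The `Finset` of all words over the alphabet `k` of length at most `n`. -/
def wordsLe (k : Type) [DecidableEq k] [Fintype k] : ℕ → Finset (List k)
  | 0 => {[]}
  | n + 1 => wordsLe k n ∪ (Finset.univ ×ˢ wordsLe k n).image fun q => q.1 :: q.2

/-- The derivative of `u` along the vector field `X`. -/
def fieldDeriv (X : Spt → Spt) (u : Spt → ℝ) : Spt → ℝ := fun p => fderiv ℝ u p (X p)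

/-- The coordinate vector fields of spacetime. -/
def coordVec : Fin 4 → Spt :=
  ![(1, 0), (0, EuclideanSpace.single 0 1), (0, EuclideanSpace.single 1 1),
    (0, EuclideanSpace.single 2 1)]

/-- The vector field of the Lorentz boost `L_a`, as a linear map. -/
def boostField (a : Fin 3) : Spt →L[ℝ] Spt :=
  ((EuclideanSpace.proj a : E3 →L[ℝ] ℝ).comp (ContinuousLinearMap.snd ℝ ℝ E3)).prod
    ((ContinuousLinearMap.fst ℝ ℝ E3).smulRight (EuclideanSpace.single a (1 : ℝ)))

/-- The weight `s/t`. -/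
def weight (q : Spt) : ℝ := Real.sqrt (q.1 ^ 2 - ‖q.2‖ ^ 2) / q.1

lemma boostField_apply (a : Fin 3) (p : Spt) :
    boostField a p = (p.2 a, p.1 • EuclideanSpace.single a (1 : ℝ)) := by
  simp [boostField]

lemma coordVec_succ (a : Fin 3) : coordVec a.succ = (0, EuclideanSpace.single a 1) := by
  fin_cases a <;> rfl

lemma pd_eq_fieldDeriv (β : Fin 4) (u : Spt → ℝ) :
    pd β u = fieldDeriv (fun _ => coordVec β) u := by
  fin_cases β <;> rfl

lemma lb_eq_fieldDeriv (a : Fin 3) (u : Spt → ℝ) : lb a u = fieldDeriv (boostField a) u := by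
  funext p
  have h : boostField a p
      = p.2 a • ((1, 0) : Spt) + p.1 • ((0, EuclideanSpace.single a (1 : ℝ)) : Spt) := by
    rw [boostField_apply]
    simp
  simp only [fieldDeriv, h, map_add, map_smul, smul_eq_mul]
  rfl

lemma isOpen_lightCone : IsOpen lightCone :=
  isOpen_lt (by fun_prop) (by fun_prop)

lemma one_lt_time {p : Spt} (hp : p ∈ lightCone) : 1 < p.1 := by
  have h : ‖p.2‖ < p.1 - 1 := hp
  linarith [norm_nonneg p.2]

lemma time_le_sq_sub {p : Spt} (hp : p ∈ lightCone) : p.1 ≤ p.1 ^ 2 - ‖p.2‖ ^ 2 := by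
  have h : ‖p.2‖ < p.1 - 1 := hp
  nlinarith [norm_nonneg p.2]

lemma sq_sub_pos {p : Spt} (hp : p ∈ lightCone) : 0 < p.1 ^ 2 - ‖p.2‖ ^ 2 := by
  linarith [one_lt_time hp, time_le_sq_sub hp]

section Smooth

variable {u v : Spt → ℝ}

lemma contDiffOn_fieldDeriv {X : Spt → Spt} (hX : ContDiff ℝ (⊤ : ℕ∞) X)
    (hu : ContDiffOn ℝ (⊤ : ℕ∞) u lightCone) :
    ContDiffOn ℝ (⊤ : ℕ∞) (fieldDeriv X u) lightCone :=
  (hu.fderiv_of_isOpen isOpen_lightCone (by simp)).clm_apply hX.contDiffOn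

lemma contDiffOn_pd (β : Fin 4) (hu : ContDiffOn ℝ (⊤ : ℕ∞) u lightCone) :
    ContDiffOn ℝ (⊤ : ℕ∞) (pd β u) lightCone := by
  rw [pd_eq_fieldDeriv]
  exact contDiffOn_fieldDeriv contDiff_const hu

lemma contDiffOn_lb (a : Fin 3) (hu : ContDiffOn ℝ (⊤ : ℕ∞) u lightCone) :
    ContDiffOn ℝ (⊤ : ℕ∞) (lb a u) lightCone := by
  rw [lb_eq_fieldDeriv]
  exact contDiffOn_fieldDeriv (boostField a).contDiff hu

lemma contDiffOn_pdW (I : List (Fin 4)) (hu : ContDiffOn ℝ (⊤ : ℕ∞) u lightCone) :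
    ContDiffOn ℝ (⊤ : ℕ∞) (pdW I u) lightCone := by
  induction I with
  | nil => exact hu
  | cons β I ih => exact contDiffOn_pd β ih

lemma contDiffOn_lbW (J : List (Fin 3)) (hu : ContDiffOn ℝ (⊤ : ℕ∞) u lightCone) :
    ContDiffOn ℝ (⊤ : ℕ∞) (lbW J u) lightCone := by
  induction J with
  | nil => exact hu
  | cons a J ih => exact contDiffOn_lb a ih

lemma differentiableAt_of_contDiffOn (hu : ContDiffOn ℝ (⊤ : ℕ∞) u lightCone) {p : Spt}
    (hp : p ∈ lightCone) : DifferentiableAt ℝ u p :=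
  (hu.contDiffAt (isOpen_lightCone.mem_nhds hp)).differentiableAt (by simp)

lemma fieldDeriv_congr (X : Spt → Spt) (h : Set.EqOn u v lightCone) :
    Set.EqOn (fieldDeriv X u) (fieldDeriv X v) lightCone := fun p hp => by
  simp only [fieldDeriv]
  rw [(h.eventuallyEq_of_mem (isOpen_lightCone.mem_nhds hp)).fderiv_eq]

lemma fieldDeriv_add (X : Spt → Spt) {p : Spt} (hu : DifferentiableAt ℝ u p)
    (hv : DifferentiableAt ℝ v p) :
    fieldDeriv X (fun q => u q + v q) p = fieldDeriv X u p + fieldDeriv X v p := by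
  simp [fieldDeriv, fderiv_fun_add hu hv]

lemma fieldDeriv_mul (X : Spt → Spt) {p : Spt} (hu : DifferentiableAt ℝ u p)
    (hv : DifferentiableAt ℝ v p) :
    fieldDeriv X (fun q => u q * v q) p = fieldDeriv X u p * v p + u p * fieldDeriv X v p := by
  simp [fieldDeriv, fderiv_fun_mul hu hv]
  ring

lemma fieldDeriv_fieldDeriv_comm (A : Spt →L[ℝ] Spt) (e : Spt)
    (hu : ContDiffOn ℝ (⊤ : ℕ∞) u lightCone) {p : Spt} (hp : p ∈ lightCone) (c : Spt) :
    fieldDeriv (fun q => A q + c) (fieldDeriv (fun _ => e) u) p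
      = fieldDeriv (fun _ => e) (fieldDeriv (fun q => A q + c) u) p
        - fieldDeriv (fun _ => A e) u p := by
  have hat := hu.contDiffAt (isOpen_lightCone.mem_nhds hp)
  have hd : DifferentiableAt ℝ (fderiv ℝ u) p :=
    ((hu.fderiv_of_isOpen (m := (⊤ : ℕ∞)) isOpen_lightCone (by simp)).contDiffAt
      (isOpen_lightCone.mem_nhds hp)).differentiableAt (by simp)
  have hs : IsSymmSndFDerivAt ℝ u p := hat.isSymmSndFDerivAt <| by
    rw [minSmoothness_of_isRCLikeNormedField]
    exact WithTop.coe_le_coe.2 (le_top : (2 : ℕ∞) ≤ ⊤)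
  have hA : DifferentiableAt ℝ (fun q => A q + c) p := by fun_prop
  have hA' : fderiv ℝ (fun q => A q + c) p = A := by
    rw [fderiv_add_const]
    exact A.fderiv
  have h1 : fderiv ℝ (fun q => fderiv ℝ u q e) p (A p + c)
      = fderiv ℝ (fderiv ℝ u) p (A p + c) e := by
    rw [fderiv_clm_apply hd (by fun_prop)]
    simp
  have h2 : fderiv ℝ (fun q => fderiv ℝ u q (A q + c)) p e
      = fderiv ℝ (fderiv ℝ u) p e (A p + c) + fderiv ℝ u p (A e) := by
    rw [fderiv_clm_apply hd hA, hA']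
    simp [add_comm]
  change fderiv ℝ (fun q => fderiv ℝ u q e) p (A p + c)
    = fderiv ℝ (fun q => fderiv ℝ u q (A q + c)) p e - fderiv ℝ u p (A e)
  rw [h1, h2, hs.eq e (A p + c)]
  ring

lemma pd_pd_comm (γ β : Fin 4) (hu : ContDiffOn ℝ (⊤ : ℕ∞) u lightCone) {p : Spt}
    (hp : p ∈ lightCone) : pd γ (pd β u) p = pd β (pd γ u) p := by
  simpa [pd_eq_fieldDeriv, fieldDeriv] using
    fieldDeriv_fieldDeriv_comm 0 (coordVec β) hu hp (coordVec γ)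

lemma lb_pd_comm (a : Fin 3) (β : Fin 4) (hu : ContDiffOn ℝ (⊤ : ℕ∞) u lightCone) {p : Spt}
    (hp : p ∈ lightCone) :
    lb a (pd β u) p = pd β (lb a u) p - fieldDeriv (fun _ => boostField a (coordVec β)) u p := by
  simpa [pd_eq_fieldDeriv, lb_eq_fieldDeriv] using
    fieldDeriv_fieldDeriv_comm (boostField a) (coordVec β) hu hp 0

end Smooth

lemma boostField_coordVec (a : Fin 3) (β : Fin 4) :
    ∃ (c : ℝ) (γ : Fin 4), boostField a (coordVec β) = c • coordVec γ := by
  refine Fin.cases ⟨1, a.succ, ?_⟩ (fun b => ⟨if a = b then 1 else 0, 0, ?_⟩) β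
  · rw [coordVec_succ, boostField_apply]
    simp [coordVec]
  · rw [coordVec_succ, boostField_apply]
    by_cases h : a = b <;> simp [coordVec, h]

section Generators

variable {p : Spt}

lemma hasFDerivAt_sq_sub (p : Spt) :
    HasFDerivAt (fun q : Spt => q.1 ^ 2 - ‖q.2‖ ^ 2)
      ((2 * p.1) • ContinuousLinearMap.fst ℝ ℝ E3
        - (2 : ℝ) • (innerSL ℝ p.2).comp (ContinuousLinearMap.snd ℝ ℝ E3)) p := by
  have h1 : HasFDerivAt (fun q : Spt => q.1) (ContinuousLinearMap.fst ℝ ℝ E3) p := hasFDerivAt_fst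
  have h2 : HasFDerivAt (fun q : Spt => q.2) (ContinuousLinearMap.snd ℝ ℝ E3) p := hasFDerivAt_snd
  exact ((h1.pow 2).sub h2.norm_sq).congr_fderiv (by ext <;> simp)

lemma fieldDeriv_inv_time (X : Spt → Spt) (hp : p ∈ lightCone) :
    fieldDeriv X (fun q => q.1⁻¹) p = -(X p).1 * p.1⁻¹ ^ 2 := by
  have ht := (zero_lt_one.trans (one_lt_time hp)).ne'
  have h1 : HasFDerivAt (fun q : Spt => q.1) (ContinuousLinearMap.fst ℝ ℝ E3) p := hasFDerivAt_fst
  have e : fderiv ℝ (fun q : Spt => q.1⁻¹) p = _ :=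
    ((hasDerivAt_inv ht).comp_hasFDerivAt p h1).fderiv
  rw [fieldDeriv, e]
  simp
  ring

lemma fieldDeriv_coord (X : Spt → Spt) (b : Fin 3) (p : Spt) :
    fieldDeriv X (fun q => q.2 b) p = (X p).2 b := by
  have h : HasFDerivAt (fun q : Spt => q.2 b)
      ((EuclideanSpace.proj b : E3 →L[ℝ] ℝ).comp (ContinuousLinearMap.snd ℝ ℝ E3)) p :=
    ((EuclideanSpace.proj b : E3 →L[ℝ] ℝ).comp (ContinuousLinearMap.snd ℝ ℝ E3)).hasFDerivAt
  rw [fieldDeriv, h.fderiv]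
  simp

lemma fieldDeriv_time (X : Spt → Spt) (p : Spt) :
    fieldDeriv X (fun q => q.1) p = (X p).1 := by
  have h1 : HasFDerivAt (fun q : Spt => q.1) (ContinuousLinearMap.fst ℝ ℝ E3) p := hasFDerivAt_fst
  rw [fieldDeriv, h1.fderiv]
  simp

lemma differentiableAt_inv_time (hp : p ∈ lightCone) :
    DifferentiableAt ℝ (fun q : Spt => q.1⁻¹) p :=
  differentiableAt_fst.inv (zero_lt_one.trans (one_lt_time hp)).ne'

lemma differentiableAt_coord (b : Fin 3) (p : Spt) :
    DifferentiableAt ℝ (fun q : Spt => q.2 b) p := by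
  fun_prop

lemma fieldDeriv_velocity (X : Spt → Spt) (b : Fin 3) (hp : p ∈ lightCone) :
    fieldDeriv X (fun q => q.2 b * q.1⁻¹) p
      = (X p).2 b * p.1⁻¹ - p.2 b * (X p).1 * p.1⁻¹ ^ 2 := by
  rw [fieldDeriv_mul X (differentiableAt_coord b p) (differentiableAt_inv_time hp),
    fieldDeriv_coord, fieldDeriv_inv_time X hp]
  ring

lemma fieldDeriv_time_div (X : Spt → Spt) (hp : p ∈ lightCone) :
    fieldDeriv X (fun q => q.1 * (q.1 ^ 2 - ‖q.2‖ ^ 2)⁻¹) p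
      = (X p).1 * (p.1 ^ 2 - ‖p.2‖ ^ 2)⁻¹
        - 2 * p.1 * (p.1 * (X p).1 - inner ℝ p.2 (X p).2) * (p.1 ^ 2 - ‖p.2‖ ^ 2)⁻¹ ^ 2 := by
  have h := (hasDerivAt_inv (sq_sub_pos hp).ne').comp_hasFDerivAt p (hasFDerivAt_sq_sub p)
  have h' : fieldDeriv X (fun q => (q.1 ^ 2 - ‖q.2‖ ^ 2)⁻¹) p
      = -2 * (p.1 * (X p).1 - inner ℝ p.2 (X p).2) * (p.1 ^ 2 - ‖p.2‖ ^ 2)⁻¹ ^ 2 := by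
    have e : fderiv ℝ (fun q : Spt => (q.1 ^ 2 - ‖q.2‖ ^ 2)⁻¹) p = _ := h.fderiv
    rw [fieldDeriv, e]
    simp
    ring
  have hd : DifferentiableAt ℝ (fun q : Spt => (q.1 ^ 2 - ‖q.2‖ ^ 2)⁻¹) p := h.differentiableAt
  rw [fieldDeriv_mul X differentiableAt_fst hd, h', fieldDeriv_time]
  ring

lemma differentiableAt_weight (hp : p ∈ lightCone) : DifferentiableAt ℝ weight p :=
  ((hasFDerivAt_sq_sub p).sqrt (sq_sub_pos hp).ne').differentiableAt.mul
    (differentiableAt_inv_time hp)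

lemma fieldDeriv_weight (X : Spt → Spt) (hp : p ∈ lightCone) :
    fieldDeriv X weight p = weight p *
      ((p.1 * (X p).1 - inner ℝ p.2 (X p).2) * (p.1 ^ 2 - ‖p.2‖ ^ 2)⁻¹ - (X p).1 * p.1⁻¹) := by
  have hpos := sq_sub_pos hp
  have h := (hasFDerivAt_sq_sub p).sqrt hpos.ne'
  have ht := (zero_lt_one.trans (one_lt_time hp)).ne'
  have hs := (Real.sqrt_pos.2 hpos).ne'
  have e : fieldDeriv X (fun q => √(q.1 ^ 2 - ‖q.2‖ ^ 2)) p
      = √(p.1 ^ 2 - ‖p.2‖ ^ 2) * (p.1 * (X p).1 - inner ℝ p.2 (X p).2)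
        * (p.1 ^ 2 - ‖p.2‖ ^ 2)⁻¹ := by
    rw [fieldDeriv, h.fderiv]
    nth_rewrite 3 [← Real.sq_sqrt hpos.le]
    simp
    field_simp
  change fieldDeriv X (fun q => √(q.1 ^ 2 - ‖q.2‖ ^ 2) * q.1⁻¹) p = _
  rw [fieldDeriv_mul X h.differentiableAt (differentiableAt_inv_time hp), e,
    fieldDeriv_inv_time X hp, weight]
  ring

end Generators

/-- Functions agreeing on the light cone with a polynomial in `1/t`, `x^b/t` and `t/s²`. These are
bounded there, and stable under coordinate derivatives and boosts. -/
inductive IsCoeff : (Spt → ℝ) → Prop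
  | const (c : ℝ) : IsCoeff fun _ => c
  | inv_time : IsCoeff fun q => q.1⁻¹
  | velocity (b : Fin 3) : IsCoeff fun q => q.2 b * q.1⁻¹
  | time_div : IsCoeff fun q => q.1 * (q.1 ^ 2 - ‖q.2‖ ^ 2)⁻¹
  | add {f g : Spt → ℝ} : IsCoeff f → IsCoeff g → IsCoeff fun q => f q + g q
  | mul {f g : Spt → ℝ} : IsCoeff f → IsCoeff g → IsCoeff fun q => f q * g q
  | congr {f g : Spt → ℝ} : IsCoeff f → Set.EqOn g f lightCone → IsCoeff g

namespace IsCoeff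

variable {f : Spt → ℝ}

lemma differentiableAt (hf : IsCoeff f) {p : Spt} (hp : p ∈ lightCone) :
    DifferentiableAt ℝ f p := by
  induction hf with
  | const c => fun_prop
  | inv_time => exact differentiableAt_inv_time hp
  | velocity b => exact (differentiableAt_coord b p).mul (differentiableAt_inv_time hp)
  | time_div =>
    exact differentiableAt_fst.mul
      ((hasFDerivAt_sq_sub p).differentiableAt.inv (sq_sub_pos hp).ne')
  | add _ _ ih₁ ih₂ => exact ih₁.add ih₂
  | mul _ _ ih₁ ih₂ => exact ih₁.mul ih₂
  | congr _ h ih =>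
    exact ih.congr_of_eventuallyEq (h.eventuallyEq_of_mem (isOpen_lightCone.mem_nhds hp))

lemma bounded (hf : IsCoeff f) : ∃ B : ℝ, 0 ≤ B ∧ ∀ p ∈ lightCone, |f p| ≤ B := by
  induction hf with
  | const c => exact ⟨|c|, abs_nonneg c, fun _ _ => le_rfl⟩
  | inv_time =>
    refine ⟨1, zero_le_one, fun p hp => ?_⟩
    have ht := one_lt_time hp
    rw [abs_inv, abs_of_pos (by linarith)]
    exact inv_le_one_of_one_le₀ ht.le
  | velocity b =>
    refine ⟨1, zero_le_one, fun p hp => ?_⟩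
    have ht := one_lt_time hp
    have h : ‖p.2‖ < p.1 - 1 := hp
    have hb : |p.2 b| ≤ ‖p.2‖ := PiLp.norm_apply_le p.2 b
    rw [abs_mul, abs_inv, abs_of_pos (by linarith : 0 < p.1), ← div_eq_mul_inv,
      div_le_one (by linarith)]
    linarith
  | time_div =>
    refine ⟨1, zero_le_one, fun p hp => ?_⟩
    have ht := one_lt_time hp
    have hs := sq_sub_pos hp
    rw [abs_mul, abs_inv, abs_of_pos (by linarith : 0 < p.1), abs_of_pos hs, ← div_eq_mul_inv,
      div_le_one hs]
    exact time_le_sq_sub hp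
  | add _ _ ih₁ ih₂ =>
    obtain ⟨B, hB, h₁⟩ := ih₁
    obtain ⟨B', hB', h₂⟩ := ih₂
    exact ⟨B + B', add_nonneg hB hB', fun p hp =>
      (abs_add_le _ _).trans (add_le_add (h₁ p hp) (h₂ p hp))⟩
  | mul _ _ ih₁ ih₂ =>
    obtain ⟨B, hB, h₁⟩ := ih₁
    obtain ⟨B', hB', h₂⟩ := ih₂
    refine ⟨B * B', mul_nonneg hB hB', fun p hp => ?_⟩
    rw [abs_mul]
    exact mul_le_mul (h₁ p hp) (h₂ p hp) (abs_nonneg _) hB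
  | congr _ h ih =>
    obtain ⟨B, hB, h₁⟩ := ih
    exact ⟨B, hB, fun p hp => by rw [h hp]; exact h₁ p hp⟩

lemma fieldDeriv_of_generators {X : Spt → Spt}
    (ht : IsCoeff (fieldDeriv X fun q => q.1⁻¹))
    (hx : ∀ b : Fin 3, IsCoeff (fieldDeriv X fun q => q.2 b * q.1⁻¹))
    (hs : IsCoeff (fieldDeriv X fun q => q.1 * (q.1 ^ 2 - ‖q.2‖ ^ 2)⁻¹)) (hf : IsCoeff f) :
    IsCoeff (fieldDeriv X f) := by
  induction hf with
  | const c => exact (const 0).congr fun p _ => by simp [fieldDeriv]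
  | inv_time => exact ht
  | velocity b => exact hx b
  | time_div => exact hs
  | add h₁ h₂ ih₁ ih₂ =>
    exact (ih₁.add ih₂).congr fun p hp =>
      fieldDeriv_add X (h₁.differentiableAt hp) (h₂.differentiableAt hp)
  | mul h₁ h₂ ih₁ ih₂ =>
    exact ((ih₁.mul h₂).add (h₁.mul ih₂)).congr fun p hp =>
      fieldDeriv_mul X (h₁.differentiableAt hp) (h₂.differentiableAt hp)
  | congr _ h ih => exact ih.congr (fieldDeriv_congr X h)

lemma pd (β : Fin 4) (hf : IsCoeff f) : IsCoeff (pd β f) := by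
  rw [pd_eq_fieldDeriv]
  have hw := inv_time
  have hv := time_div
  refine Fin.cases ?_ (fun a => ?_) β
  · refine fieldDeriv_of_generators ?_ (fun b => ?_) ?_ hf
    · exact ((const (-1)).mul (hw.mul hw)).congr fun p hp => by
        rw [fieldDeriv_inv_time _ hp]
        simp [coordVec]
        ring
    · exact ((const (-1)).mul ((velocity b).mul hw)).congr fun p hp => by
        rw [fieldDeriv_velocity _ b hp]
        simp [coordVec]
        ring
    · exact ((hw.mul hv).add ((const (-2)).mul (hv.mul hv))).congr fun p hp => by
        have ht := (zero_lt_one.trans (one_lt_time hp)).ne'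
        rw [fieldDeriv_time_div _ hp]
        simp [coordVec]
        field_simp
        ring
  · rw [coordVec_succ]
    refine fieldDeriv_of_generators ?_ (fun b => ?_) ?_ hf
    · exact (const 0).congr fun p hp => by
        rw [fieldDeriv_inv_time _ hp]
        simp
    · exact ((const (if b = a then 1 else 0)).mul hw).congr fun p hp => by
        rw [fieldDeriv_velocity _ b hp]
        simp
    · exact ((const 2).mul ((velocity a).mul (hv.mul hv))).congr fun p hp => by
        have ht := (zero_lt_one.trans (one_lt_time hp)).ne'
        rw [fieldDeriv_time_div _ hp]
        simp [EuclideanSpace.inner_single_right]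
        field_simp

lemma lb (a : Fin 3) (hf : IsCoeff f) : IsCoeff (lb a f) := by
  rw [lb_eq_fieldDeriv]
  refine fieldDeriv_of_generators ?_ (fun b => ?_) ?_ hf
  · exact ((const (-1)).mul ((velocity a).mul inv_time)).congr fun p hp => by
      rw [fieldDeriv_inv_time _ hp, boostField_apply]
      ring
  · exact ((const (if b = a then 1 else 0)).add
        ((const (-1)).mul ((velocity a).mul (velocity b)))).congr fun p hp => by
      have ht := (zero_lt_one.trans (one_lt_time hp)).ne'
      rw [fieldDeriv_velocity _ b hp, boostField_apply]
      by_cases h : b = a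
      · simp [h]
        field_simp
        ring
      · simp [h]
        field_simp
  · exact ((velocity a).mul time_div).congr fun p hp => by
      have ht := (zero_lt_one.trans (one_lt_time hp)).ne'
      rw [fieldDeriv_time_div _ hp, boostField_apply]
      simp [EuclideanSpace.inner_single_right, inner_smul_right]
      field_simp

end IsCoeff

lemma exists_isCoeff_pd_weight (β : Fin 4) :
    ∃ g, IsCoeff g ∧ ∀ p ∈ lightCone, pd β weight p = weight p * g p := by
  rw [pd_eq_fieldDeriv]
  refine Fin.cases ?_ (fun a => ?_) β
  · refine ⟨_, IsCoeff.time_div.add ((IsCoeff.const (-1)).mul .inv_time), fun p hp => ?_⟩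
    rw [fieldDeriv_weight _ hp]
    simp only [coordVec, Matrix.cons_val_zero, inner_zero_right]
    ring
  · refine ⟨_, (IsCoeff.const (-1)).mul ((IsCoeff.velocity a).mul .time_div), fun p hp => ?_⟩
    have ht := (zero_lt_one.trans (one_lt_time hp)).ne'
    rw [fieldDeriv_weight _ hp, coordVec_succ]
    simp [EuclideanSpace.inner_single_right]
    field_simp
    simp

lemma exists_isCoeff_lb_weight (a : Fin 3) :
    ∃ g, IsCoeff g ∧ ∀ p ∈ lightCone, lb a weight p = weight p * g p := by
  refine ⟨_, (IsCoeff.const (-1)).mul (IsCoeff.velocity a), fun p hp => ?_⟩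
  rw [lb_eq_fieldDeriv, fieldDeriv_weight _ hp, boostField_apply]
  simp [EuclideanSpace.inner_single_right, inner_smul_right]

/-- Operators acting on smooth functions on the light cone as a finite combination of the
weighted derivatives `(s/t) ∂_β ∂^I L^J`, `|I| ≤ m`, `|J| ≤ n`, with coefficients in `IsCoeff`. -/
inductive IsWeightedComb (m n : ℕ) : ((Spt → ℝ) → Spt → ℝ) → Prop
  | term {f : Spt → ℝ} (hf : IsCoeff f) (β : Fin 4) {I : List (Fin 4)} {J : List (Fin 3)}
      (hI : I.length ≤ m) (hJ : J.length ≤ n) :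
      IsWeightedComb m n fun u p => weight p * (f p * pd β (pdW I (lbW J u)) p)
  | add {S T : (Spt → ℝ) → Spt → ℝ} : IsWeightedComb m n S → IsWeightedComb m n T →
      IsWeightedComb m n fun u p => S u p + T u p
  | congr {S T : (Spt → ℝ) → Spt → ℝ} : IsWeightedComb m n S →
      (∀ u, ContDiffOn ℝ (⊤ : ℕ∞) u lightCone → Set.EqOn (T u) (S u) lightCone) →
      IsWeightedComb m n T

lemma mem_wordsLe {k : Type} [DecidableEq k] [Fintype k] {n : ℕ} {I : List k}
    (h : I.length ≤ n) : I ∈ wordsLe k n := by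
  induction n generalizing I with
  | zero => simpa [wordsLe] using h
  | succ n ih =>
    cases I with
    | nil => exact Finset.mem_union_left _ (ih (Nat.zero_le n))
    | cons a I =>
      refine Finset.mem_union_right _ (Finset.mem_image.2 ⟨(a, I), ?_, rfl⟩)
      exact Finset.mem_product.2 ⟨Finset.mem_univ _, ih (by simpa using h)⟩

namespace IsWeightedComb

variable {m n : ℕ} {T : (Spt → ℝ) → Spt → ℝ}

lemma differentiableAt (hT : IsWeightedComb m n T) {u : Spt → ℝ}
    (hu : ContDiffOn ℝ (⊤ : ℕ∞) u lightCone) {p : Spt} (hp : p ∈ lightCone) :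
    DifferentiableAt ℝ (T u) p := by
  induction hT with
  | term hf β hI hJ =>
    exact (differentiableAt_weight hp).mul ((hf.differentiableAt hp).mul
      (differentiableAt_of_contDiffOn
        (contDiffOn_pd β (contDiffOn_pdW _ (contDiffOn_lbW _ hu))) hp))
  | add _ _ ih₁ ih₂ => exact ih₁.add ih₂
  | congr _ h ih =>
    exact ih.congr_of_eventuallyEq ((h u hu).eventuallyEq_of_mem (isOpen_lightCone.mem_nhds hp))

/-- Leibniz rule for a term of a weighted combination. -/
lemma fieldDeriv_term (X : Spt → Spt) {f g w : Spt → ℝ} (hf : IsCoeff f)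
    (hg : ∀ p ∈ lightCone, fieldDeriv X weight p = weight p * g p)
    (hw : ContDiffOn ℝ (⊤ : ℕ∞) w lightCone) {p : Spt} (hp : p ∈ lightCone) :
    fieldDeriv X (fun q => weight q * (f q * w q)) p
      = weight p * ((g p * f p + fieldDeriv X f p) * w p)
        + weight p * (f p * fieldDeriv X w p) := by
  have h₁ := hf.differentiableAt hp
  have h₂ := differentiableAt_of_contDiffOn hw hp
  have h₃ : DifferentiableAt ℝ (fun q => f q * w q) p := h₁.mul h₂
  rw [fieldDeriv_mul X (differentiableAt_weight hp) h₃, fieldDeriv_mul X h₁ h₂, hg p hp]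
  ring

lemma pd (γ : Fin 4) (hT : IsWeightedComb m n T) :
    IsWeightedComb (m + 1) n fun u => pd γ (T u) := by
  induction hT with
  | @term f hf β I J hI hJ =>
    obtain ⟨g, hg, hgw⟩ := exists_isCoeff_pd_weight γ
    refine ((term ((hg.mul hf).add (hf.pd γ)) β (Nat.le_succ_of_le hI) hJ).add
      (term hf β (I := γ :: I) (Nat.succ_le_succ hI) hJ)).congr fun u hu p hp => ?_
    have hw := contDiffOn_pdW I (contDiffOn_lbW J hu)
    have hc := pd_pd_comm γ β hw hp
    rw [pd_eq_fieldDeriv γ] at hgw hc ⊢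
    simp only [pd_eq_fieldDeriv γ, pdW]
    rw [fieldDeriv_term _ hf hgw (contDiffOn_pd β hw) hp, hc]
    simp only [pd_eq_fieldDeriv γ]
  | add h₁ h₂ ih₁ ih₂ =>
    refine (ih₁.add ih₂).congr fun u hu p hp => ?_
    simp only [pd_eq_fieldDeriv γ]
    exact fieldDeriv_add _ (h₁.differentiableAt hu hp) (h₂.differentiableAt hu hp)
  | congr _ h ih =>
    refine ih.congr fun u hu => ?_
    simp only [pd_eq_fieldDeriv γ]
    exact fieldDeriv_congr _ (h u hu)

lemma lb (a : Fin 3) (hT : IsWeightedComb 0 n T) :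
    IsWeightedComb 0 (n + 1) fun u => lb a (T u) := by
  induction hT with
  | @term f hf β I J hI hJ =>
    obtain rfl : I = [] := List.length_eq_zero_iff.1 (Nat.le_zero.1 hI)
    obtain ⟨g, hg, hgw⟩ := exists_isCoeff_lb_weight a
    obtain ⟨c, γ, hγ⟩ := boostField_coordVec a β
    refine (((term ((hg.mul hf).add (hf.lb a)) β hI (Nat.le_succ_of_le hJ)).add
      (term hf β (J := a :: J) hI (Nat.succ_le_succ hJ))).add
      (term ((IsCoeff.const (-c)).mul hf) γ hI (Nat.le_succ_of_le hJ))).congr fun u hu p hp => ?_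
    have hw := contDiffOn_lbW J hu
    have hc := lb_pd_comm a β hw hp
    have hd : fieldDeriv (fun _ => c • coordVec γ) (lbW J u) p = c * _root_.pd γ (lbW J u) p := by
      simp [pd_eq_fieldDeriv, fieldDeriv]
    rw [hγ, hd] at hc
    simp only [pdW, lbW]
    rw [lb_eq_fieldDeriv a] at hc
    simp only [lb_eq_fieldDeriv a] at hgw hc ⊢
    rw [fieldDeriv_term _ hf hgw (contDiffOn_pd β hw) hp, hc]
    ring
  | add h₁ h₂ ih₁ ih₂ =>
    refine (ih₁.add ih₂).congr fun u hu p hp => ?_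
    simp only [lb_eq_fieldDeriv a]
    exact fieldDeriv_add _ (h₁.differentiableAt hu hp) (h₂.differentiableAt hu hp)
  | congr _ h ih =>
    refine ih.congr fun u hu => ?_
    simp only [lb_eq_fieldDeriv a]
    exact fieldDeriv_congr _ (h u hu)

lemma of_words (I : List (Fin 4)) (J : List (Fin 3)) (α : Fin 4) :
    IsWeightedComb I.length J.length fun u =>
      pdW I (lbW J fun q => weight q * _root_.pd α u q) := by
  induction I with
  | nil =>
    induction J with
    | nil =>
      exact (term (IsCoeff.const 1) α (I := []) (J := []) le_rfl le_rfl).congr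
        fun u _ p _ => by simp [pdW, lbW]
    | cons a J ih => exact ih.lb a
  | cons γ I ih => exact ih.pd γ

lemma bound (hT : IsWeightedComb m n T) :
    ∃ C : ℝ, ∀ u, ContDiffOn ℝ (⊤ : ℕ∞) u lightCone → ∀ p ∈ lightCone,
      |T u p| ≤ C * ∑ β : Fin 4, ∑ I ∈ wordsLe (Fin 4) m, ∑ J ∈ wordsLe (Fin 3) n,
        |weight p * _root_.pd β (pdW I (lbW J u)) p| := by
  induction hT with
  | @term f hf β I J hI hJ =>
    obtain ⟨B, hB, hfB⟩ := hf.bounded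
    refine ⟨B, fun u _ p hp => ?_⟩
    have hle : |weight p * _root_.pd β (pdW I (lbW J u)) p| ≤
        ∑ β : Fin 4, ∑ I ∈ wordsLe (Fin 4) m, ∑ J ∈ wordsLe (Fin 3) n,
          |weight p * _root_.pd β (pdW I (lbW J u)) p| := by
      refine le_trans ?_ (Finset.single_le_sum (fun β _ => ?_) (Finset.mem_univ β))
      · refine le_trans ?_ (Finset.single_le_sum (fun I _ => ?_) (mem_wordsLe hI))
        · exact Finset.single_le_sum
            (f := fun J => |weight p * _root_.pd β (pdW I (lbW J u)) p|)
            (fun J _ => abs_nonneg _) (mem_wordsLe hJ)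
        · positivity
      · positivity
    beta_reduce
    rw [mul_left_comm, abs_mul]
    exact mul_le_mul (hfB p hp) hle (abs_nonneg _) hB
  | add _ _ ih₁ ih₂ =>
    obtain ⟨C, h₁⟩ := ih₁
    obtain ⟨C', h₂⟩ := ih₂
    refine ⟨C + C', fun u hu p hp => ?_⟩
    rw [add_mul]
    exact (abs_add_le _ _).trans (add_le_add (h₁ u hu p hp) (h₂ u hu p hp))
  | congr _ h ih =>
    obtain ⟨C, h₁⟩ := ih
    exact ⟨C, fun u hu p hp => by rw [h u hu hp]; exact h₁ u hu p hp⟩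

end IsWeightedComb

/-- Commutator estimate for the weight `s/t = √(t² − |x|²)/t`: for words of given lengths
`m = |I|`, `n = |J|` there is a constant `C` depending only on `m` and `n` such that, inside
the future light cone,
`|∂^I L^J((s/t) ∂_α u)| ≤ |(s/t) ∂_α ∂^I L^J u| + C Σ_{β,|I′|≤|I|,|J′|≤|J|} |(s/t) ∂_β ∂^{I′} L^{J′} u|`. -/
theorem commutator_weight_estimate (m n : ℕ) :
    ∃ C : ℝ, 0 < C ∧
      ∀ (I : List (Fin 4)) (J : List (Fin 3)), I.length = m → J.length = n →
      ∀ α : Fin 4, ∀ u : Spt → ℝ, ContDiffOn ℝ (⊤ : ℕ∞) u lightCone →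
        ∀ p ∈ lightCone,
          |pdW I (lbW J fun q => Real.sqrt (q.1 ^ 2 - ‖q.2‖ ^ 2) / q.1 * pd α u q) p| ≤
            |Real.sqrt (p.1 ^ 2 - ‖p.2‖ ^ 2) / p.1 * pd α (pdW I (lbW J u)) p|
              + C * ∑ β : Fin 4, ∑ I' ∈ wordsLe (Fin 4) m, ∑ J' ∈ wordsLe (Fin 3) n,
                  |Real.sqrt (p.1 ^ 2 - ‖p.2‖ ^ 2) / p.1 * pd β (pdW I' (lbW J' u)) p| := by
  choose c hc using fun (I : List (Fin 4)) (J : List (Fin 3)) (α : Fin 4) =>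
    (IsWeightedComb.of_words I J α).bound
  set C : ℝ := ∑ I ∈ wordsLe (Fin 4) m, ∑ J ∈ wordsLe (Fin 3) n, ∑ α : Fin 4, |c I J α|
  have hC0 : 0 ≤ C := by positivity
  refine ⟨C + 1, by linarith, fun I J hI hJ α u hu p hp => ?_⟩
  have hle : c I J α ≤ C := by
    refine (le_abs_self _).trans ?_
    refine le_trans ?_ (Finset.single_le_sum (fun I _ => ?_) (mem_wordsLe hI.le))
    · refine le_trans ?_ (Finset.single_le_sum (fun J _ => ?_) (mem_wordsLe hJ.le))
      · exact Finset.single_le_sum (f := fun α => |c I J α|) (fun α _ => abs_nonneg _)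
          (Finset.mem_univ α)
      · positivity
    · positivity
  have h := hc I J α u hu p hp
  rw [hI, hJ] at h
  refine h.trans (le_trans ?_ (le_add_of_nonneg_left (abs_nonneg _)))
  exact mul_le_mul_of_nonneg_right (by linarith) (by positivity)
end
end

section
/- Let U ⊆ ℝ⁴ be open and let g = (g_{αβ})_{0 ≤ α,β ≤ 3} : U → ℝ^{4×4} be a twice continuously differentiable field of symmetric invertible matrices, with pointwise inverse (g^{αβ}). Then at every point of U the Ricci curvature satisfies R_{αβ} = −(1/2) g^{λδ} ∂_λ∂_δ g_{αβ} + (1/2)( ∂_α Γ_β + ∂_β Γ_α ) + (1/2) F_{αβ}, where F_{αβ} = P_{αβ} + Q_{αβ} + W_{αβ} with P_{αβ} = −(1/2) g^{λλ′} g^{δδ′} ∂_α g_{δλ′} ∂_β g_{λδ′} + (1/4) g^{δδ′} g^{λλ′} ∂_β g_{δδ′} ∂_α g_{λλ′}, W_{αβ} = g^{δδ′} ∂_δ g_{αβ} Γ_{δ′} − Γ_α Γ_β, and Q_{αβ} = g^{λλ′} g^{δδ′} ∂_δ g_{αλ′} ∂_{δ′} g_{βλ} − g^{λλ′} g^{δδ′}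 ( ∂_δ g_{αλ′} ∂_λ g_{βδ′} − ∂_δ g_{βδ′} ∂_λ g_{αλ′} ) + g^{λλ′} g^{δδ′} ( ∂_α g_{λ′δ′} ∂_δ g_{λβ} − ∂_α g_{λβ} ∂_δ g_{λ′δ′} ) + (1/2) g^{λλ′} g^{δδ′} ( ∂_α g_{λβ} ∂_{λ′} g_{δδ′} − ∂_α g_{δδ′} ∂_{λ′} g_{λβ} ) + g^{λλ′} g^{δδ′} ( ∂_β g_{λ′δ′} ∂_δ g_{λα} − ∂_β g_{λα} ∂_δ g_{λ′δ′} ) + (1/2) g^{λλ′} g^{δδ′} ( ∂_β g_{λα} ∂_{λ′} g_{δδ′} − ∂_β g_{δδ′} ∂_{λ′} g_{λα} ). -/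
noncomputable section

/-- Coordinate space `ℝ⁴`. -/
abbrev V4 : Type := EuclideanSpace ℝ (Fin 4)

/-- Coordinate partial derivative `∂_μ` on `ℝ⁴`. -/
def pd4 (μ : Fin 4) (f : V4 → ℝ) : V4 → ℝ :=
  fun p => fderiv ℝ f p (EuclideanSpace.single μ 1)

/-- First derivatives of the metric: `dg g μ α β = ∂_μ g_{αβ}`. -/
def dg (g : V4 → Fin 4 → Fin 4 → ℝ) (μ α β : Fin 4) : V4 → ℝ :=
  pd4 μ fun q => g q α β

/-- Christoffel symbols
`Γ^λ_{αβ} = ½ g^{λλ′}(∂_α g_{βλ′} + ∂_β g_{αλ′} − ∂_{λ′} g_{αβ})`. -/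
def Chr (g ginv : V4 → Fin 4 → Fin 4 → ℝ) (lam α β : Fin 4) : V4 → ℝ :=
  fun p => (1 / 2) * ∑ l' : Fin 4, ginv p lam l' *
    (dg g α β l' p + dg g β α l' p - dg g l' α β p)

/-- Ricci curvature
`R_{αβ} = ∂_λ Γ^λ_{αβ} − ∂_α Γ^λ_{βλ} + Γ^λ_{αβ} Γ^δ_{λδ} − Γ^λ_{αδ} Γ^δ_{βλ}`. -/
def Ricci (g ginv : V4 → Fin 4 → Fin 4 → ℝ) (α β : Fin 4) : V4 → ℝ :=
  fun p =>
    (∑ lam : Fin 4, pd4 lam (Chr g ginv lam α β) p)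
      - (∑ lam : Fin 4, pd4 α (Chr g ginv lam β lam) p)
      + (∑ lam : Fin 4, ∑ δ : Fin 4, Chr g ginv lam α β p * Chr g ginv δ lam δ p)
      - (∑ lam : Fin 4, ∑ δ : Fin 4, Chr g ginv lam α δ p * Chr g ginv δ β lam p)

/-- Contracted Christoffel symbols `Γ^γ = g^{αβ} Γ^γ_{αβ}`. -/
def GammaUp (g ginv : V4 → Fin 4 → Fin 4 → ℝ) (γ : Fin 4) : V4 → ℝ :=
  fun p => ∑ α : Fin 4, ∑ β : Fin 4, ginv p α β * Chr g ginv γ α β p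

/-- Lowered contracted Christoffel symbols `Γ_α = g_{αβ} Γ^β`. -/
def GammaLow (g ginv : V4 → Fin 4 → Fin 4 → ℝ) (α : Fin 4) : V4 → ℝ :=
  fun p => ∑ β : Fin 4, g p α β * GammaUp g ginv β p

/-- Quasi-null terms
`P_{αβ} = −½ g^{λλ′} g^{δδ′} ∂_α g_{δλ′} ∂_β g_{λδ′} + ¼ g^{δδ′} g^{λλ′} ∂_β g_{δδ′} ∂_α g_{λλ′}`. -/
def Pquasi (g ginv : V4 → Fin 4 → Fin 4 → ℝ) (α β : Fin 4) : V4 → ℝ :=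
  fun p =>
    -(1 / 2) * (∑ l : Fin 4, ∑ l' : Fin 4, ∑ d : Fin 4, ∑ d' : Fin 4,
        ginv p l l' * ginv p d d' * dg g α d l' p * dg g β l d' p)
      + (1 / 4) * ∑ d : Fin 4, ∑ d' : Fin 4, ∑ l : Fin 4, ∑ l' : Fin 4,
          ginv p d d' * ginv p l l' * dg g β d d' p * dg g α l l' p

/-- Remainder terms `W_{αβ} = g^{δδ′} ∂_δ g_{αβ} Γ_{δ′} − Γ_α Γ_β`. -/
def Wrem (g ginv : V4 → Fin 4 → Fin 4 → ℝ) (α β : Fin 4) : V4 → ℝ :=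
  fun p =>
    (∑ d : Fin 4, ∑ d' : Fin 4, ginv p d d' * dg g d α β p * GammaLow g ginv d' p)
      - GammaLow g ginv α p * GammaLow g ginv β p

/-- Null terms `Q_{αβ}` (sum of the six groups of null quadratic terms). -/
def Qnull (g ginv : V4 → Fin 4 → Fin 4 → ℝ) (α β : Fin 4) : V4 → ℝ :=
  fun p => ∑ l : Fin 4, ∑ l' : Fin 4, ∑ d : Fin 4, ∑ d' : Fin 4,
    ginv p l l' * ginv p d d' *
      (dg g d α l' p * dg g d' β l p
        - (dg g d α l' p * dg g l β d' p - dg g d β d' p * dg g l α l' p)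
        + (dg g α l' d' p * dg g d l β p - dg g α l β p * dg g d l' d' p)
        + (1 / 2) * (dg g α l β p * dg g l' d d' p - dg g α d d' p * dg g l' l β p)
        + (dg g β l' d' p * dg g d l α p - dg g β l α p * dg g d l' d' p)
        + (1 / 2) * (dg g β l α p * dg g l' d d' p - dg g β d d' p * dg g l' l α p))

open Topology

section Contraction

variable {ι : Type*} [Fintype ι]

/-- The contraction `h^{lm} F_{lm}`. -/
def contract₂ (h F : ι → ι → ℝ) : ℝ := ∑ l, ∑ m, h l m * F l m

/-- The double contraction `h^{lm} h^{de} F_{lmde}`. -/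
def contract₄ (h : ι → ι → ℝ) (F : ι → ι → ι → ι → ℝ) : ℝ :=
  ∑ l, ∑ m, ∑ d, ∑ e, h l m * h d e * F l m d e

lemma contract₂_add (h F G : ι → ι → ℝ) :
    contract₂ h F + contract₂ h G = contract₂ h fun l m => F l m + G l m := by
  simp only [contract₂, mul_add, Finset.sum_add_distrib]

lemma contract₂_smul (c : ℝ) (h F : ι → ι → ℝ) :
    c * contract₂ h F = contract₂ h fun l m => c * F l m := by
  simp only [contract₂, Finset.mul_sum]
  refine Finset.sum_congr rfl fun l _ => Finset.sum_congr rfl fun m _ => ?_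
  ring

lemma contract₄_add (h : ι → ι → ℝ) (F G : ι → ι → ι → ι → ℝ) :
    contract₄ h F + contract₄ h G = contract₄ h fun l m d e => F l m d e + G l m d e := by
  simp only [contract₄, mul_add, Finset.sum_add_distrib]

lemma contract₄_smul (c : ℝ) (h : ι → ι → ℝ) (F : ι → ι → ι → ι → ℝ) :
    c * contract₄ h F = contract₄ h fun l m d e => c * F l m d e := by
  simp only [contract₄, Finset.mul_sum]
  refine Finset.sum_congr rfl fun l _ => Finset.sum_congr rfl fun m _ =>
    Finset.sum_congr rfl fun d _ => Finset.sum_congr rfl fun e _ => ?_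
  ring

lemma contract₂_swap {h : ι → ι → ℝ} (hh : ∀ i j, h i j = h j i) (F : ι → ι → ℝ) :
    contract₂ h F = contract₂ h fun l m => F m l := by
  unfold contract₂
  rw [Finset.sum_comm]
  simp only [hh]

lemma contract₄_swap_left {h : ι → ι → ℝ} (hh : ∀ i j, h i j = h j i)
    (F : ι → ι → ι → ι → ℝ) :
    contract₄ h F = contract₄ h fun l m d e => F m l d e := by
  unfold contract₄
  rw [Finset.sum_comm]
  refine Finset.sum_congr rfl fun l _ => Finset.sum_congr rfl fun m _ => ?_
  rw [hh m l]

lemma contract₄_swap_pairs (h : ι → ι → ℝ) (F : ι → ι → ι → ι → ℝ) :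
    contract₄ h F = contract₄ h fun l m d e => F d e l m := by
  unfold contract₄
  calc _ = ∑ l, ∑ d, ∑ m, ∑ e, h l m * h d e * F l m d e :=
        Finset.sum_congr rfl fun l _ => Finset.sum_comm
    _ = ∑ d, ∑ l, ∑ m, ∑ e, h l m * h d e * F l m d e := Finset.sum_comm
    _ = ∑ d, ∑ l, ∑ e, ∑ m, h l m * h d e * F l m d e :=
        Finset.sum_congr rfl fun d _ => Finset.sum_congr rfl fun l _ => Finset.sum_comm
    _ = ∑ d, ∑ e, ∑ l, ∑ m, h l m * h d e * F l m d e :=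
        Finset.sum_congr rfl fun d _ => Finset.sum_comm
    _ = _ := by simp only [mul_comm (h _ _) (h _ _)]

/-- Double contractions agree when the symmetrizations of the contracted tensors do. -/
lemma contract₄_eq_of_symmetrization_eq {h : ι → ι → ℝ} (hh : ∀ i j, h i j = h j i)
    {F G : ι → ι → ι → ι → ℝ}
    (hFG : ∀ l m d e,
      F l m d e + F m l d e + (F l m e d + F m l e d)
        + (F d e l m + F e d l m + (F d e m l + F e d m l))
      = G l m d e + G m l d e + (G l m e d + G m l e d)
        + (G d e l m + G e d l m + (G d e m l + G e d m l))) :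
    contract₄ h F = contract₄ h G := by
  have right (F : ι → ι → ι → ι → ℝ) :
      contract₄ h F = contract₄ h fun l m d e => F l m e d := by
    rw [contract₄_swap_pairs, contract₄_swap_left hh, contract₄_swap_pairs]
  have key (F : ι → ι → ι → ι → ℝ) : 8 * contract₄ h F = contract₄ h fun l m d e =>
      F l m d e + F m l d e + (F l m e d + F m l e d)
        + (F d e l m + F e d l m + (F d e m l + F e d m l)) := by
    have left := contract₄_add h F fun l m d e => F m l d e
    rw [← contract₄_swap_left hh F] at left
    have left_right := contract₄_add h (fun l m d e => F l m d e + F m l d e)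
      fun l m d e => F l m e d + F m l e d
    rw [← right fun l m d e => F l m d e + F m l d e] at left_right
    have all := contract₄_add h
      (fun l m d e => F l m d e + F m l d e + (F l m e d + F m l e d))
      fun l m d e => F d e l m + F e d l m + (F d e m l + F e d m l)
    rw [← contract₄_swap_pairs h
      fun l m d e => F l m d e + F m l d e + (F l m e d + F m l e d)] at all
    linarith
  have := (key F).trans ((congrArg (contract₄ h) (by funext l m d e; exact hFG l m d e)).trans
    (key G).symm)
  linarith

lemma contract₂_eq_of_symmetrization_eq {h : ι → ι → ℝ} (hh : ∀ i j, h i j = h j i)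
    {F G : ι → ι → ℝ} (hFG : ∀ l m, F l m + F m l = G l m + G m l) :
    contract₂ h F = contract₂ h G := by
  have key (F : ι → ι → ℝ) : 2 * contract₂ h F = contract₂ h fun l m => F l m + F m l := by
    rw [← contract₂_add, ← contract₂_swap hh F]
    ring
  have := (key F).trans ((congrArg (contract₂ h) (by funext l m; exact hFG l m)).trans
    (key G).symm)
  linarith

lemma contract₂_mul_contract₂ (h F G : ι → ι → ℝ) :
    contract₂ h F * contract₂ h G = contract₄ h fun l m d e => F l m * G d e := by
  simp only [contract₂, contract₄, Finset.sum_mul]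
  simp only [Finset.mul_sum]
  refine Finset.sum_congr rfl fun l _ => Finset.sum_congr rfl fun m _ =>
    Finset.sum_congr rfl fun d _ => Finset.sum_congr rfl fun e _ => ?_
  ring

lemma sum_mul_sum_eq_contract₄ (h : ι → ι → ℝ) (F G : ι → ι → ι → ℝ) :
    ∑ l, ∑ d, (∑ m, h l m * F l d m) * ∑ e, h d e * G l d e
      = contract₄ h fun l m d e => F l d m * G l d e := by
  unfold contract₄
  refine Finset.sum_congr rfl fun l _ => ?_
  simp only [Finset.sum_mul_sum]
  rw [Finset.sum_comm]
  refine Finset.sum_congr rfl fun m _ => Finset.sum_congr rfl fun d _ =>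
    Finset.sum_congr rfl fun e _ => ?_
  ring

lemma sum_conj_mul_eq_contract₄ (h : ι → ι → ℝ) (E : ι → ι → ι → ℝ) (F : ι → ι → ℝ) :
    ∑ l, ∑ e, (∑ m, ∑ d, h l m * E l m d * h d e) * F l e
      = contract₄ h fun l m d e => E l m d * F l e := by
  unfold contract₄
  refine Finset.sum_congr rfl fun l _ => ?_
  simp only [Finset.sum_mul]
  rw [Finset.sum_comm]
  refine Finset.sum_congr rfl fun m _ => ?_
  rw [Finset.sum_comm]
  refine Finset.sum_congr rfl fun d _ => Finset.sum_congr rfl fun e _ => ?_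
  ring

end Contraction

section PartialDerivative

variable {p : V4} {f k : V4 → ℝ} (μ : Fin 4)

lemma pd4_congr (h : f =ᶠ[𝓝 p] k) : pd4 μ f p = pd4 μ k p := by
  simp only [pd4, h.fderiv_eq]

lemma pd4_const (c : ℝ) : pd4 μ (fun _ => c) p = 0 := by
  simp [pd4]

lemma pd4_add (hf : DifferentiableAt ℝ f p) (hk : DifferentiableAt ℝ k p) :
    pd4 μ (fun q => f q + k q) p = pd4 μ f p + pd4 μ k p := by
  simp only [pd4, fderiv_fun_add hf hk, add_apply]

lemma pd4_sub (hf : DifferentiableAt ℝ f p) (hk : DifferentiableAt ℝ k p) :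
    pd4 μ (fun q => f q - k q) p = pd4 μ f p - pd4 μ k p := by
  simp only [pd4, fderiv_fun_sub hf hk, sub_apply]

lemma pd4_mul (hf : DifferentiableAt ℝ f p) (hk : DifferentiableAt ℝ k p) :
    pd4 μ (fun q => f q * k q) p = pd4 μ f p * k p + f p * pd4 μ k p := by
  simp only [pd4, fderiv_fun_mul hf hk, add_apply,
    smul_apply, smul_eq_mul]
  ring

lemma pd4_const_mul (c : ℝ) (hf : DifferentiableAt ℝ f p) :
    pd4 μ (fun q => c * f q) p = c * pd4 μ f p := by
  rw [pd4_mul μ (differentiableAt_const c) hf, pd4_const]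
  ring

lemma pd4_sum {ι : Type*} (s : Finset ι) {F : ι → V4 → ℝ}
    (hF : ∀ i ∈ s, DifferentiableAt ℝ (F i) p) :
    pd4 μ (fun q => ∑ i ∈ s, F i q) p = ∑ i ∈ s, pd4 μ (F i) p := by
  simp only [pd4, fderiv_fun_sum hF, sum_apply]

lemma differentiableAt_pd4 (hf : ContDiffAt ℝ 2 f p) : DifferentiableAt ℝ (pd4 μ f) p :=
  ((hf.fderiv_right (m := 1) (by norm_num)).differentiableAt one_ne_zero).clm_apply
    (differentiableAt_const _)

lemma pd4_pd4_comm (hf : ContDiffAt ℝ 2 f p) (ν : Fin 4) :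
    pd4 μ (pd4 ν f) p = pd4 ν (pd4 μ f) p := by
  have hd : DifferentiableAt ℝ (fderiv ℝ f) p :=
    (hf.fderiv_right (m := 1) (by norm_num)).differentiableAt one_ne_zero
  have key (μ ν : Fin 4) : pd4 μ (pd4 ν f) p
      = fderiv ℝ (fderiv ℝ f) p (EuclideanSpace.single μ 1) (EuclideanSpace.single ν 1) := by
    unfold pd4
    rw [fderiv_clm_apply hd (differentiableAt_const _)]
    simp
  rw [key, key]
  exact hf.isSymmSndFDerivAt (by simp) _ _

end PartialDerivative

section MatrixInverse

variable {E n : Type*} [NormedAddCommGroup E] [NormedSpace ℝ E] [Fintype n] [DecidableEq n]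

lemma DifferentiableAt.matrix_det {M : E → Matrix n n ℝ} {p : E}
    (hM : ∀ i j, DifferentiableAt ℝ (fun q => M q i j) p) :
    DifferentiableAt ℝ (fun q => (M q).det) p := by
  simp only [Matrix.det_apply]
  fun_prop

lemma DifferentiableAt.matrix_inv_apply {M : E → Matrix n n ℝ} {p : E}
    (hM : ∀ i j, DifferentiableAt ℝ (fun q => M q i j) p) (hp : (M p).det ≠ 0) (i j : n) :
    DifferentiableAt ℝ (fun q => (M q)⁻¹ i j) p := by
  have hadj : DifferentiableAt ℝ (fun q => (M q).adjugate i j) p := by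
    simp only [Matrix.adjugate_apply]
    refine DifferentiableAt.matrix_det fun k l => ?_
    by_cases hk : k = j
    · simp [Matrix.updateRow_apply, hk]
    · simpa [Matrix.updateRow_apply, hk] using hM k l
  simp only [Matrix.inv_def, Matrix.smul_apply, Ring.inverse_eq_inv', smul_eq_mul]
  exact ((DifferentiableAt.matrix_det hM).inv hp).mul hadj

end MatrixInverse

section InverseMetric

variable {U : Set V4} {g ginv : V4 → Fin 4 → Fin 4 → ℝ}

lemma metric_mul_inverse
    (hinv : ∀ p ∈ U, ∀ α β : Fin 4,
      (∑ γ : Fin 4, g p α γ * ginv p γ β) = if α = β then 1 else 0) {p : V4} (hp : p ∈ U) :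
    Matrix.of (g p) * Matrix.of (ginv p) = 1 := by
  ext i j
  simpa [Matrix.mul_apply, Matrix.one_apply] using hinv p hp i j

lemma inverse_metric_symm (hsym : ∀ p ∈ U, ∀ α β : Fin 4, g p α β = g p β α)
    (hinv : ∀ p ∈ U, ∀ α β : Fin 4,
      (∑ γ : Fin 4, g p α γ * ginv p γ β) = if α = β then 1 else 0) {p : V4} (hp : p ∈ U)
    (α β : Fin 4) : ginv p α β = ginv p β α := by
  have h1 := metric_mul_inverse hinv hp
  have hg : (Matrix.of (g p)).transpose = Matrix.of (g p) := by
    ext i j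
    exact hsym p hp j i
  have h2 : (Matrix.of (ginv p)).transpose = Matrix.of (ginv p) := by
    rw [← Matrix.inv_eq_right_inv h1, Matrix.transpose_nonsing_inv, hg]
  exact congrFun (congrFun h2 β) α

lemma differentiableAt_inverse_metric (hU : IsOpen U)
    (hreg : ∀ α β : Fin 4, ContDiffOn ℝ 2 (fun p => g p α β) U)
    (hinv : ∀ p ∈ U, ∀ α β : Fin 4,
      (∑ γ : Fin 4, g p α γ * ginv p γ β) = if α = β then 1 else 0) {p : V4} (hp : p ∈ U)
    (α β : Fin 4) : DifferentiableAt ℝ (fun q => ginv q α β) p := by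
  have hd : (Matrix.of (g p)).det ≠ 0 := by
    intro h0
    have := congrArg Matrix.det (metric_mul_inverse hinv hp)
    simp [h0] at this
  have hdiff := DifferentiableAt.matrix_inv_apply (M := fun q => Matrix.of (g q)) (p := p)
    (fun i j => ((hreg i j).contDiffAt (hU.mem_nhds hp)).differentiableAt two_ne_zero) hd α β
  refine hdiff.congr_of_eventuallyEq ?_
  filter_upwards [hU.mem_nhds hp] with q hq
  rw [Matrix.inv_eq_right_inv (metric_mul_inverse hinv hq)]
  rfl

/-- `∂_μ g^{αβ} = -g^{αγ} g^{δβ} ∂_μ g_{γδ}`. -/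
lemma pd4_inverse_metric (hU : IsOpen U)
    (hreg : ∀ α β : Fin 4, ContDiffOn ℝ 2 (fun p => g p α β) U)
    (hinv : ∀ p ∈ U, ∀ α β : Fin 4,
      (∑ γ : Fin 4, g p α γ * ginv p γ β) = if α = β then 1 else 0) {p : V4} (hp : p ∈ U)
    (μ α β : Fin 4) :
    pd4 μ (fun q => ginv q α β) p
      = -∑ γ, ∑ δ, ginv p α γ * dg g μ γ δ p * ginv p δ β := by
  have hg (i j : Fin 4) : DifferentiableAt ℝ (fun q => g q i j) p :=
    ((hreg i j).contDiffAt (hU.mem_nhds hp)).differentiableAt two_ne_zero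
  have hh := differentiableAt_inverse_metric hU hreg hinv hp
  have hprod (i : Fin 4) :
      ∑ δ, g p i δ * pd4 μ (fun q => ginv q δ β) p = -∑ δ, dg g μ i δ p * ginv p δ β := by
    have h0 : pd4 μ (fun q => ∑ δ, g q i δ * ginv q δ β) p = 0 := by
      rw [pd4_congr μ (k := fun _ => if i = β then 1 else 0), pd4_const]
      filter_upwards [hU.mem_nhds hp] with q hq using hinv q hq i β
    rw [pd4_sum μ _ fun δ _ => (hg i δ).fun_mul (hh δ β)] at h0
    simp only [pd4_mul μ (hg i _) (hh _ β), Finset.sum_add_distrib] at h0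
    simp only [dg]
    linarith
  have hleft := mul_eq_one_comm.mp (metric_mul_inverse hinv hp)
  have hleft' (i j : Fin 4) : ∑ γ, ginv p i γ * g p γ j = if i = j then 1 else 0 := by
    simpa [Matrix.mul_apply, Matrix.one_apply] using congrFun (congrFun hleft i) j
  calc pd4 μ (fun q => ginv q α β) p
      = ∑ δ, (∑ γ, ginv p α γ * g p γ δ) * pd4 μ (fun q => ginv q δ β) p := by
        simp [hleft']
    _ = ∑ γ, ginv p α γ * ∑ δ, g p γ δ * pd4 μ (fun q => ginv q δ β) p := by
        simp only [Finset.sum_mul, Finset.mul_sum]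
        rw [Finset.sum_comm]
        simp only [mul_assoc]
    _ = _ := by
        simp only [hprod, mul_neg, Finset.sum_neg_distrib, Finset.mul_sum, mul_assoc]

/-- `Γ_α = ½ g^{γδ} (∂_γ g_{δα} + ∂_δ g_{γα} - ∂_α g_{γδ})`. -/
lemma GammaLow_eq
    (hinv : ∀ p ∈ U, ∀ α β : Fin 4,
      (∑ γ : Fin 4, g p α γ * ginv p γ β) = if α = β then 1 else 0) {p : V4} (hp : p ∈ U)
    (α : Fin 4) :
    GammaLow g ginv α p = (1 / 2) * ∑ γ, ∑ δ, ginv p γ δ *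
      (dg g γ δ α p + dg g δ γ α p - dg g α γ δ p) := by
  have lower (γ δ : Fin 4) : ∑ β, g p α β * Chr g ginv β γ δ p
      = (1 / 2) * (dg g γ δ α p + dg g δ γ α p - dg g α γ δ p) := by
    simp only [Chr, mul_left_comm (g p α _) (1 / 2 : ℝ), ← Finset.mul_sum]
    congr 1
    simp only [Finset.mul_sum, ← mul_assoc]
    rw [Finset.sum_comm]
    simp [← Finset.sum_mul, hinv p hp]
  simp only [GammaLow, GammaUp, Finset.mul_sum]
  rw [Finset.sum_comm]
  refine Finset.sum_congr rfl fun γ _ => ?_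
  rw [Finset.sum_comm]
  refine Finset.sum_congr rfl fun δ _ => ?_
  simp only [mul_left_comm (g p α _) (ginv p γ δ), ← Finset.mul_sum, lower]
  ring

end InverseMetric

/-- Decomposition of the Ricci curvature of a `C²` field of symmetric invertible
matrices on an open set `U ⊆ ℝ⁴`:
`R_{αβ} = −½ g^{λδ} ∂_λ∂_δ g_{αβ} + ½(∂_α Γ_β + ∂_β Γ_α) + ½ F_{αβ}` with
`F_{αβ} = P_{αβ} + Q_{αβ} + W_{αβ}`. -/
theorem ricci_curvature_decomposition
    (U : Set V4) (hU : IsOpen U)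
    (g ginv : V4 → Fin 4 → Fin 4 → ℝ)
    (hreg : ∀ α β : Fin 4, ContDiffOn ℝ 2 (fun p => g p α β) U)
    (hsym : ∀ p ∈ U, ∀ α β : Fin 4, g p α β = g p β α)
    (hinv : ∀ p ∈ U, ∀ α β : Fin 4,
      (∑ γ : Fin 4, g p α γ * ginv p γ β) = if α = β then 1 else 0) :
    ∀ p ∈ U, ∀ α β : Fin 4,
      Ricci g ginv α β p =
        -(1 / 2) * (∑ l : Fin 4, ∑ d : Fin 4, ginv p l d * pd4 l (pd4 d fun q => g q α β) p)
          + (1 / 2) * (pd4 α (GammaLow g ginv β) p + pd4 β (GammaLow g ginv α) p)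
          + (1 / 2) * (Pquasi g ginv α β p + Qnull g ginv α β p + Wrem g ginv α β p) := by
  intro p hp α β
  have hreg' (i j : Fin 4) : ContDiffAt ℝ 2 (fun q => g q i j) p :=
    (hreg i j).contDiffAt (hU.mem_nhds hp)
  have hh := inverse_metric_symm hsym hinv hp
  have hhd := differentiableAt_inverse_metric hU hreg hinv hp
  have hdh := pd4_inverse_metric hU hreg hinv hp
  have hDd (μ i j : Fin 4) : DifferentiableAt ℝ (dg g μ i j) p :=
    differentiableAt_pd4 μ (hreg' i j)
  have dg_symm (q : V4) (hq : q ∈ U) (μ i j : Fin 4) : dg g μ i j q = dg g μ j i q := by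
    refine pd4_congr μ ?_
    filter_upwards [hU.mem_nhds hq] with r hr using hsym r hr i j
  have hKd (μ ν i j k l m n o : Fin 4) : DifferentiableAt ℝ
      (fun q => dg g μ ν i q + dg g j k l q - dg g m n o q) p :=
    ((hDd _ _ _).fun_add (hDd _ _ _)).fun_sub (hDd _ _ _)
  have pd4_K (κ μ ν i j k l m n o : Fin 4) :
      pd4 κ (fun q => dg g μ ν i q + dg g j k l q - dg g m n o q) p
        = pd4 κ (dg g μ ν i) p + pd4 κ (dg g j k l) p - pd4 κ (dg g m n o) p := by
    rw [pd4_sub κ ((hDd _ _ _).fun_add (hDd _ _ _)) (hDd _ _ _), pd4_add κ (hDd _ _ _) (hDd _ _ _)]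
  have pd4_Chr (κ l i j : Fin 4) : pd4 κ (Chr g ginv l i j) p = (1 / 2) *
      (∑ x, ginv p l x * (pd4 κ (dg g i j x) p + pd4 κ (dg g j i x) p - pd4 κ (dg g x i j) p)
        - ∑ x, (∑ y, ∑ z, ginv p l y * dg g κ y z p * ginv p z x) *
          (dg g i j x p + dg g j i x p - dg g x i j p)) := by
    unfold Chr
    rw [pd4_const_mul κ _ (DifferentiableAt.fun_sum fun x _ => (hhd _ _).fun_mul (hKd ..)),
      pd4_sum κ _ fun x _ => (hhd _ _).fun_mul (hKd ..), ← Finset.sum_sub_distrib]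
    congr 1
    refine Finset.sum_congr rfl fun x _ => ?_
    rw [pd4_mul κ (hhd _ _) (hKd ..), pd4_K, hdh]
    ring
  have pd4_Gamma (κ i : Fin 4) : pd4 κ (GammaLow g ginv i) p = (1 / 2) *
      (contract₂ (ginv p) (fun c d =>
          pd4 κ (dg g c d i) p + pd4 κ (dg g d c i) p - pd4 κ (dg g i c d) p)
        - contract₄ (ginv p) fun l m d e =>
          dg g κ m d p * (dg g l e i p + dg g e l i p - dg g i l e p)) := by
    rw [pd4_congr κ (k := fun q => (1 / 2) * ∑ γ, ∑ δ, ginv q γ δ *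
      (dg g γ δ i q + dg g δ γ i q - dg g i γ δ q))]
    · rw [pd4_const_mul κ _ (DifferentiableAt.fun_sum fun x _ =>
          DifferentiableAt.fun_sum fun y _ => (hhd _ _).fun_mul (hKd ..)),
        pd4_sum κ _ fun x _ => DifferentiableAt.fun_sum fun y _ => (hhd _ _).fun_mul (hKd ..),
        ← sum_conj_mul_eq_contract₄ (ginv p) (fun _ m d => dg g κ m d p)
          fun l e => dg g l e i p + dg g e l i p - dg g i l e p, contract₂,
        ← Finset.sum_sub_distrib]
      congr 1
      refine Finset.sum_congr rfl fun x _ => ?_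
      rw [pd4_sum κ _ fun y _ => (hhd _ _).fun_mul (hKd ..), ← Finset.sum_sub_distrib]
      refine Finset.sum_congr rfl fun y _ => ?_
      rw [pd4_mul κ (hhd _ _) (hKd ..), pd4_K, hdh]
      ring
    · filter_upwards [hU.mem_nhds hp] with q hq using GammaLow_eq hinv hq i
  have div_Chr : ∑ l, pd4 l (Chr g ginv l α β) p = (1 / 2) *
      (contract₂ (ginv p) (fun l x =>
          pd4 l (dg g α β x) p + pd4 l (dg g β α x) p - pd4 l (dg g x α β) p)
        - contract₄ (ginv p) fun l m d e =>
          dg g l m d p * (dg g α β e p + dg g β α e p - dg g e α β p)) := by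
    rw [← sum_conj_mul_eq_contract₄ (ginv p) (fun l m d => dg g l m d p)
      fun _ e => dg g α β e p + dg g β α e p - dg g e α β p]
    simp only [pd4_Chr, ← Finset.mul_sum, Finset.sum_sub_distrib, contract₂]
  have pd4_trace_Chr : ∑ l, pd4 α (Chr g ginv l β l) p = (1 / 2) *
      (contract₂ (ginv p) (fun l x =>
          pd4 α (dg g β l x) p + pd4 α (dg g l β x) p - pd4 α (dg g x β l) p)
        - contract₄ (ginv p) fun l m d e =>
          dg g α m d p * (dg g β l e p + dg g l β e p - dg g e β l p)) := by
    rw [← sum_conj_mul_eq_contract₄ (ginv p) (fun _ m d => dg g α m d p)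
      fun l e => dg g β l e p + dg g l β e p - dg g e β l p]
    simp only [pd4_Chr, ← Finset.mul_sum, Finset.sum_sub_distrib, contract₂]
  have quarter (x y : ℝ) : (1 / 2 * x) * (1 / 2 * y) = (1 / 4) * (x * y) := by ring
  have Chr_mul₁ : ∑ l, ∑ d, Chr g ginv l α β p * Chr g ginv d l d p
      = (1 / 4) * contract₄ (ginv p) fun l m d e =>
        (dg g α β m p + dg g β α m p - dg g m α β p)
          * (dg g l d e p + dg g d l e p - dg g e l d p) := by
    rw [← sum_mul_sum_eq_contract₄ (ginv p)
      (fun _ _ m => dg g α β m p + dg g β α m p - dg g m α β p)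
      fun l d e => dg g l d e p + dg g d l e p - dg g e l d p]
    simp only [Chr, quarter, ← Finset.mul_sum]
  have Chr_mul₂ : ∑ l, ∑ d, Chr g ginv l α d p * Chr g ginv d β l p
      = (1 / 4) * contract₄ (ginv p) fun l m d e =>
        (dg g α d m p + dg g d α m p - dg g m α d p)
          * (dg g β l e p + dg g l β e p - dg g e β l p) := by
    rw [← sum_mul_sum_eq_contract₄ (ginv p)
      (fun _ d m => dg g α d m p + dg g d α m p - dg g m α d p)
      fun l _ e => dg g β l e p + dg g l β e p - dg g e β l p]
    simp only [Chr, quarter, ← Finset.mul_sum]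
  have Gamma_eq (i : Fin 4) : GammaLow g ginv i p = (1 / 2) * contract₂ (ginv p)
      fun c d => dg g c d i p + dg g d c i p - dg g i c d p := GammaLow_eq hinv hp i
  have P_eq : Pquasi g ginv α β p = contract₄ (ginv p) fun l m d e =>
      -(1 / 2) * (dg g α d m p * dg g β l e p) + (1 / 4) * (dg g β l m p * dg g α d e p) := by
    rw [← contract₄_add, ← contract₄_smul, ← contract₄_smul]
    simp only [Pquasi, contract₄, mul_assoc]
  have W_eq : Wrem g ginv α β p = contract₄ (ginv p) fun l m d e =>
      (1 / 2) * (dg g l α β p * (dg g d e m p + dg g e d m p - dg g m d e p))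
        + -(1 / 4) * ((dg g l m α p + dg g m l α p - dg g α l m p)
          * (dg g d e β p + dg g e d β p - dg g β d e p)) := by
    rw [← contract₄_add, ← contract₄_smul, ← contract₄_smul,
      ← contract₂_mul_contract₂ (ginv p) (fun l m => dg g l m α p + dg g m l α p - dg g α l m p)
        fun d e => dg g d e β p + dg g e d β p - dg g β d e p]
    simp only [Wrem, Gamma_eq, quarter]
    rw [neg_mul, ← sub_eq_add_neg]
    congr 1
    simp only [contract₂, contract₄, Finset.mul_sum]
    refine Finset.sum_congr rfl fun l _ => Finset.sum_congr rfl fun m _ =>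
      Finset.sum_congr rfl fun d _ => Finset.sum_congr rfl fun e _ => ?_
    ring
  have Q_eq : Qnull g ginv α β p = contract₄ (ginv p) fun l m d e => _ := rfl
  have hD := dg_symm p hp
  have hS (κ μ i j : Fin 4) : pd4 κ (dg g μ i j) p = pd4 κ (dg g μ j i) p := by
    refine pd4_congr κ ?_
    filter_upwards [hU.mem_nhds hp] with q hq using dg_symm q hq μ i j
  have hS' (κ μ i j : Fin 4) : pd4 κ (dg g μ i j) p = pd4 μ (dg g κ i j) p :=
    pd4_pd4_comm κ (hreg' i j) μ
  have second_order := contract₂_eq_of_symmetrization_eq hh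
    (F := fun l m =>
      (pd4 l (dg g α β m) p + pd4 l (dg g β α m) p - pd4 l (dg g m α β) p)
        + -1 * (pd4 α (dg g β l m) p + pd4 α (dg g l β m) p - pd4 α (dg g m β l) p))
    (G := fun l m =>
      -1 * pd4 l (dg g m α β) p
        + (1 / 2) * (pd4 α (dg g l m β) p + pd4 α (dg g m l β) p - pd4 α (dg g β l m) p)
        + (1 / 2) * (pd4 β (dg g l m α) p + pd4 β (dg g m l α) p - pd4 β (dg g α l m) p))
    (by
      intro l m
      simp only [hS, hS']
      ring)
  have assemble {a b c d e T₁ T₂ T₃ T₄ T₅ T₆ P Q W : ℝ}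
      (h₂ : a + -1 * b = -1 * c + (1 / 2) * d + (1 / 2) * e)
      (h₄ : -2 * T₁ + 2 * T₂ + T₃ + -1 * T₄ = -1 * T₅ + -1 * T₆ + 2 * P + 2 * Q + 2 * W) :
      (1 / 2) * (a - T₁) - (1 / 2) * (b - T₂) + (1 / 4) * T₃ - (1 / 4) * T₄
        = -(1 / 2) * c + (1 / 2) * ((1 / 2) * (d - T₅) + (1 / 2) * (e - T₆))
          + (1 / 2) * (P + Q + W) := by
    linarith
  have laplacian : ∑ l, ∑ d, ginv p l d * pd4 l (pd4 d fun q => g q α β) p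
      = contract₂ (ginv p) fun l m => pd4 l (dg g m α β) p := rfl
  simp only [← contract₂_add, ← contract₂_smul] at second_order
  rw [Ricci, div_Chr, pd4_trace_Chr, Chr_mul₁, Chr_mul₂, laplacian, pd4_Gamma, pd4_Gamma,
    P_eq, Q_eq, W_eq]
  refine assemble second_order ?_
  simp only [contract₄_smul, contract₄_add]
  refine contract₄_eq_of_symmetrization_eq hh fun l m d e => ?_
  simp only [hD]
  ring
end
end
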